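/- Let M = (M_j)_{j≥0} be a strongly regular sequence, let n ≥ 1, and let X be a real-analytic submanifold of an open neighborhood of the origin in ℝⁿ with 0 ∈ X. Let u₁, …, u_p be functions of class C_M on a neighborhood of 0 (i.e. each satisfies bounds |D^J u_i(x)| ≤ C σ^{|J|} |J|! M_{|J|}) that are flat on X (all partial derivatives vanish at every point of X). Then there exist an open neighborhood U of 0, a function v of class C_M on U that is flat on X ∩ U and whose zero set in U is exactly X ∩ U, and functions w₁, …, w_p of class C_M on U, flat on X ∩ U, such that u_i = v · w_i on U for every i = 1, …, p. -/

import Mathlib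

noncomputable section

open Filter MeasureTheory
open scoped Topology

def StronglyRegularWith (M : ℕ → ℝ) (A : ℝ) : Prop :=
  (∀ j, 0 < M j) ∧ M 0 = 1 ∧ Monotone M ∧
  (∀ j : ℕ, M (j + 1) * M (j + 1) ≤ M j * M (j + 2)) ∧
  1 ≤ A ∧
  (∀ j k : ℕ, M (j + k) ≤ A ^ (j + k) * (M j * M k)) ∧
  (∀ ℓ N : ℕ, ∑ j ∈ Finset.range N,
      M (ℓ + j) / (((ℓ + j : ℕ) + 1 : ℝ) * M (ℓ + j + 1)) ≤ A * (M ℓ / M (ℓ + 1)))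

def StronglyRegular (M : ℕ → ℝ) : Prop := ∃ A : ℝ, StronglyRegularWith M A

noncomputable def hfn (M : ℕ → ℝ) (t : ℝ) : ℝ :=
  if t = 0 then 0 else ⨅ j : ℕ, t ^ j * M j

def PropertyP (M : ℕ → ℝ) (γ : ℝ) : Prop :=
  ∃ (m' : ℕ → ℝ) (a : ℝ), 1 ≤ a ∧ (∀ j, 0 < m' j) ∧
    (Monotone fun j : ℕ => ((j : ℝ) + 1) ^ (-γ) * m' j) ∧
    (∀ j : ℕ, a⁻¹ * (M (j + 1) / M j) ≤ m' j ∧ m' j ≤ a * (M (j + 1) / M j))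

noncomputable def growthIndex (M : ℕ → ℝ) : ℝ :=
  sSup {γ : ℝ | 0 < γ ∧ PropertyP M γ}

def Sector (γ : ℝ) : Set ℂ :=
  {z : ℂ | z ≠ 0 ∧ |Complex.arg z| < γ * Real.pi / 2}

noncomputable def mixedPartial {n : ℕ} {F : Type*} [NormedAddCommGroup F] [NormedSpace ℝ F]
    (S : Set (EuclideanSpace ℝ (Fin n))) (f : EuclideanSpace ℝ (Fin n) → F)
    (k : ℕ) (e : Fin k → Fin n) (x : EuclideanSpace ℝ (Fin n)) : F :=
  iteratedFDerivWithin ℝ k f S x fun i => EuclideanSpace.single (e i) 1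

/-- `f` is of class `C_M` on the open set `S`: it is `C^∞` on `S` and all its mixed
partial derivatives on `S` satisfy bounds `C σ^k k! M_k`. -/
def ClassCMOn {n : ℕ} (M : ℕ → ℝ) (S : Set (EuclideanSpace ℝ (Fin n)))
    (f : EuclideanSpace ℝ (Fin n) → ℂ) : Prop :=
  ContDiffOn ℝ (⊤ : ℕ∞) f S ∧
    ∃ C σ : ℝ, 0 < C ∧ 0 < σ ∧ ∀ (k : ℕ) (e : Fin k → Fin n), ∀ x ∈ S,
      ‖mixedPartial S f k e x‖ ≤ C * σ ^ k * (Nat.factorial k : ℝ) * M k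

/-- `f` is flat on `X` (derivatives computed on `S`): all mixed partial derivatives of
`f` vanish at every point of `X`. -/
def FlatOn {n : ℕ} (S X : Set (EuclideanSpace ℝ (Fin n)))
    (f : EuclideanSpace ℝ (Fin n) → ℂ) : Prop :=
  ∀ x ∈ X, ∀ (k : ℕ) (e : Fin k → Fin n), mixedPartial S f k e x = 0

/-- `X` is a real-analytic submanifold: near each of its points it is straightened to a
linear subspace by a real-analytic local diffeomorphism. -/
def IsAnalyticSubmanifold {n : ℕ} (X : Set (EuclideanSpace ℝ (Fin n))) : Prop :=
  ∀ x ∈ X, ∃ (U W : Set (EuclideanSpace ℝ (Fin n)))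
      (φ ψ : EuclideanSpace ℝ (Fin n) → EuclideanSpace ℝ (Fin n))
      (V : Submodule ℝ (EuclideanSpace ℝ (Fin n))),
    IsOpen U ∧ x ∈ U ∧ IsOpen W ∧
    AnalyticOnNhd ℝ φ U ∧ AnalyticOnNhd ℝ ψ W ∧
    Set.MapsTo φ U W ∧ Set.MapsTo ψ W U ∧
    (∀ y ∈ U, ψ (φ y) = y) ∧ (∀ y ∈ W, φ (ψ y) = y) ∧
    φ '' (X ∩ U) = (V : Set (EuclideanSpace ℝ (Fin n))) ∩ W

/-- The derivatives of an analytic function are controlled by its power series. -/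
theorem norm_iteratedFDeriv_le_of_hasFPowerSeriesAt {E F : Type*} [NormedAddCommGroup E]
    [NormedSpace ℝ E] [NormedAddCommGroup F] [NormedSpace ℝ F] [CompleteSpace F] {f : E → F}
    {p : FormalMultilinearSeries ℝ E F} {x : E} (h : HasFPowerSeriesAt f p x) (k : ℕ) :
    ‖iteratedFDeriv ℝ k f x‖ ≤ (k.factorial : ℝ) * ‖p k‖ := by
  obtain ⟨r, hr⟩ := h
  refine ContinuousMultilinearMap.opNorm_le_bound (by positivity) fun v => ?_
  rw [hr.iteratedFDeriv_eq_sum_of_completeSpace v]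
  calc ‖∑ σ : Equiv.Perm (Fin k), p k (fun i => v (σ i))‖
      ≤ ∑ σ : Equiv.Perm (Fin k), ‖p k‖ * ∏ i, ‖v i‖ := by
        refine norm_sum_le_of_le _ fun σ _ => ?_
        rw [← Equiv.prod_comp σ]
        exact (p k).le_opNorm _
    _ = _ := by
        rw [Finset.sum_const, Finset.card_univ, Fintype.card_perm, Fintype.card_fin, nsmul_eq_mul,
          mul_assoc]

/-- Cauchy-type estimate for the composition of a holomorphic function of one variable with a
real-valued analytic function whose power series is small at scale `r`. -/
theorem norm_iteratedFDeriv_comp_ofReal_le {E : Type*} [NormedAddCommGroup E]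
    [NormedSpace ℝ E] {q : E → ℝ} {x : E} {p : FormalMultilinearSeries ℝ E ℝ}
    (hp : HasFPowerSeriesAt q p x) {Φ : ℂ → ℂ} {R r H : ℝ} (hR : 0 < R) (hr : 0 < r)
    (hΦ : DifferentiableOn ℂ Φ (Metric.closedBall (q x : ℂ) R))
    (hH : ∀ z ∈ Metric.closedBall (q x : ℂ) R, ‖Φ z‖ ≤ H)
    (hpk : ∀ k, 1 ≤ k → ‖p k‖ ≤ R / r ^ k) :
    AnalyticAt ℝ (fun y => Φ (q y)) x ∧ ∀ k, ‖iteratedFDeriv ℝ k (fun y => Φ (q y)) x‖ ≤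
      (k.factorial : ℝ) * (2 ^ k * (H / r ^ k)) := by
  have hH0 : 0 ≤ H := (norm_nonneg _).trans (hH _ (Metric.mem_closedBall_self hR.le))
  lift R to NNReal using hR.le
  have hc := (hΦ.hasFPowerSeriesOnBall (by exact_mod_cast hR)).restrictScalars (𝕜 := ℝ)
  have hq : HasFPowerSeriesAt (fun y => (q y : ℂ))
      (Complex.ofRealCLM.compFormalMultilinearSeries p) x := by
    obtain ⟨r', hr'⟩ := hp
    exact ⟨r', Complex.ofRealCLM.comp_hasFPowerSeriesOnBall hr'⟩
  have hcomp := HasFPowerSeriesAt.comp (g := Φ) (f := fun y => (q y : ℂ)) hc.hasFPowerSeriesAt hq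
  refine ⟨hcomp.analyticAt, fun k => ?_⟩
  refine (norm_iteratedFDeriv_le_of_hasFPowerSeriesAt hcomp k).trans ?_
  gcongr
  have hcoef : ∀ j, ‖(cauchyPowerSeries Φ (q x : ℂ) R).restrictScalars ℝ j‖ ≤ H * ((R : ℝ)⁻¹) ^ j := by
    intro j
    refine (le_of_eq (ContinuousMultilinearMap.norm_restrictScalars _)).trans ?_
    refine (norm_cauchyPowerSeries_le _ _ _ _).trans ?_
    rw [abs_of_pos hR]
    gcongr
    have hb : ‖∫ θ : ℝ in (0)..2 * Real.pi, ‖Φ (circleMap (q x : ℂ) R θ)‖‖ ≤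
        H * |2 * Real.pi - 0| := by
      refine intervalIntegral.norm_integral_le_of_norm_le_const fun θ _ => ?_
      rw [norm_norm]
      exact hH _ (circleMap_mem_closedBall _ hR.le _)
    rw [sub_zero, abs_of_pos Real.two_pi_pos] at hb
    calc (2 * Real.pi)⁻¹ * ∫ θ : ℝ in (0)..2 * Real.pi, ‖Φ (circleMap (q x : ℂ) R θ)‖
        ≤ (2 * Real.pi)⁻¹ * (H * (2 * Real.pi)) := by
          gcongr
          exact (Real.le_norm_self _).trans hb
      _ = H := by field_simp
  have hterm : ∀ c : Composition k,
      ‖((cauchyPowerSeries Φ (q x : ℂ) R).restrictScalars ℝ).compAlongComposition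
        (Complex.ofRealCLM.compFormalMultilinearSeries p) c‖ ≤ H / r ^ k := by
    intro c
    refine (FormalMultilinearSeries.compAlongComposition_norm _ _ c).trans ?_
    have hprod : ∏ i, ‖Complex.ofRealCLM.compFormalMultilinearSeries p (c.blocksFun i)‖ ≤
        ∏ i, (R : ℝ) / r ^ (c.blocksFun i) := by
      refine Finset.prod_le_prod (fun _ _ => norm_nonneg _) fun i _ => ?_
      refine le_trans ?_ (hpk _ (c.one_le_blocksFun i))
      refine (ContinuousLinearMap.norm_compContinuousMultilinearMap_le _ _).trans ?_
      simp
    have hsum : ∏ i, (R : ℝ) / r ^ (c.blocksFun i) = (R : ℝ) ^ c.length / r ^ k := by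
      rw [Finset.prod_div_distrib, Finset.prod_pow_eq_pow_sum, c.sum_blocksFun]
      simp
    calc _ ≤ (H * ((R : ℝ)⁻¹) ^ c.length) * ((R : ℝ) ^ c.length / r ^ k) := by
          rw [← hsum]
          gcongr
          exact hcoef _
      _ = H / r ^ k := by
          rw [inv_pow]
          have : (R : ℝ) ^ c.length ≠ 0 := (pow_pos hR _).ne'
          field_simp
  calc _ ≤ ∑ c : Composition k, H / r ^ k := norm_sum_le_of_le _ fun c _ => hterm c
    _ = (2 ^ (k - 1) : ℕ) * (H / r ^ k) := by
        rw [Finset.sum_const, Finset.card_univ, composition_card, nsmul_eq_mul]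
    _ ≤ 2 ^ k * (H / r ^ k) := by
        push_cast
        gcongr
        · norm_num
        · omega

/-- Near a point of analyticity, power series coefficients are uniformly geometrically bounded. -/
theorem AnalyticAt.exists_uniform_hasFPowerSeriesAt {E F : Type*} [NormedAddCommGroup E]
    [NormedSpace ℝ E] [NormedAddCommGroup F] [NormedSpace ℝ F] [CompleteSpace F] {f : E → F}
    (h : AnalyticAt ℝ f 0) :
    ∃ ρ C : ℝ, 0 < ρ ∧ 0 < C ∧ ∀ x ∈ Metric.ball (0 : E) ρ,
      ∃ p : FormalMultilinearSeries ℝ E F, HasFPowerSeriesAt f p x ∧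
        ∀ k, ‖p k‖ ≤ C / ρ ^ k := by
  obtain ⟨p, R, hp⟩ := h
  obtain ⟨ρ', hρ'0, hρ'⟩ := ENNReal.lt_iff_exists_nnreal_btwn.1 hp.r_pos
  set ρ : NNReal := ρ' / 2 with hρ
  have hρ0 : 0 < ρ := by
    have : 0 < ρ' := by exact_mod_cast hρ'0
    positivity
  have hρρ : (ρ + ρ : ENNReal) < p.radius := by
    have : (ρ + ρ : ENNReal) = ρ' := by
      rw [← ENNReal.coe_add, hρ, add_halves]
    rw [this]
    exact hρ'.trans_le hp.r_le
  have hS := p.changeOriginSeries_summable_aux₁ hρρ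
  set S := ∑' s : Σ k l : ℕ, { s : Finset (Fin (k + l)) // s.card = l },
      ‖p (s.1 + s.2.1)‖₊ * ρ ^ s.2.1 * ρ ^ s.1 with hSdef
  refine ⟨ρ, S + 1, by exact_mod_cast hρ0, by positivity, fun x hx => ?_⟩
  have hxρ : ‖x‖₊ < ρ := by
    rw [mem_ball_zero_iff] at hx
    exact_mod_cast hx
  have hρR : (ρ : ENNReal) < R := by
    refine lt_of_le_of_lt ?_ hρ'
    rw [hρ]
    exact_mod_cast NNReal.half_le_self _
  have hxR : (‖x‖₊ : ENNReal) < R := lt_trans (by exact_mod_cast hxρ) hρR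
  refine ⟨p.changeOrigin x, ?_, fun k => ?_⟩
  · have := (hp.changeOrigin hxR).hasFPowerSeriesAt
    rwa [zero_add] at this
  · rw [le_div_iff₀ (by positivity)]
    suffices h : ‖p.changeOrigin x k‖₊ * ρ ^ k ≤ S by
      have h' : ‖p.changeOrigin x k‖ * (ρ : ℝ) ^ k ≤ S := by exact_mod_cast h
      linarith
    have h1 := p.nnnorm_changeOrigin_le k (hxR.trans_le hp.r_le)
    have hsk := (NNReal.summable_sigma.1 hS).1 k
    have hsk' : Summable fun s : Σ l : ℕ, { s : Finset (Fin (k + l)) // s.card = l } =>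
        ‖p (k + s.1)‖₊ * ρ ^ s.1 :=
      p.changeOriginSeries_summable_aux₂ (hρR.trans_le hp.r_le) k
    calc ‖p.changeOrigin x k‖₊ * ρ ^ k
        ≤ (∑' s : Σ l : ℕ, { s : Finset (Fin (k + l)) // s.card = l },
            ‖p (k + s.1)‖₊ * ρ ^ s.1) * ρ ^ k := by
          gcongr
          refine h1.trans ?_
          refine Summable.tsum_le_tsum (fun s => by gcongr) ?_ hsk'
          exact NNReal.summable_of_le (fun s => by gcongr) hsk'
      _ = ∑' s : Σ l : ℕ, { s : Finset (Fin (k + l)) // s.card = l },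
            ‖p (k + s.1)‖₊ * ρ ^ s.1 * ρ ^ k := by rw [NNReal.tsum_mul_right]
      _ ≤ S := by
          rw [hSdef, hS.tsum_sigma' (NNReal.summable_sigma.1 hS).1]
          exact (NNReal.summable_sigma.1 hS).2.le_tsum k (fun _ _ => zero_le)

theorem ContDiffAt.hasFDerivAt_iteratedFDeriv {E F : Type*} [NormedAddCommGroup E]
    [NormedSpace ℝ E] [NormedAddCommGroup F] [NormedSpace ℝ F] {f : E → F} {x : E}
    (h : ContDiffAt ℝ (⊤ : ℕ∞) f x) (m : ℕ) :
    HasFDerivAt (iteratedFDeriv ℝ m f) (iteratedFDeriv ℝ (m + 1) f x).curryLeft x := by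
  have hd : DifferentiableAt ℝ (iteratedFDeriv ℝ m f) x :=
    h.differentiableAt_iteratedFDeriv (by exact_mod_cast WithTop.coe_lt_top m)
  exact hd.hasFDerivAt

/-- A function that is smooth off `Z`, vanishes on `Z`, and whose derivatives tend to zero
quadratically at `Z`, is smooth and flat on `Z`. -/
theorem contDiffOn_of_flat {E F : Type*} [NormedAddCommGroup E]
    [NormedSpace ℝ E] [NormedAddCommGroup F] [NormedSpace ℝ F] {f : E → F} {S Z : Set E}
    (hS : IsOpen S) (hSZ : IsOpen (S \ Z)) (hf0 : ∀ x ∈ S ∩ Z, f x = 0)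
    (hf : ∀ x ∈ S \ Z, ContDiffAt ℝ (⊤ : ℕ∞) f x)
    (hb : ∀ k : ℕ, ∃ C : ℝ, ∀ x ∈ S \ Z, ∀ y ∈ S ∩ Z,
      ‖iteratedFDeriv ℝ k f x‖ ≤ C * ‖x - y‖ ^ 2) :
    ContDiffOn ℝ (⊤ : ℕ∞) f S ∧
      (∀ k : ℕ, ∀ x ∈ S ∩ Z, iteratedFDerivWithin ℝ k f S x = 0) ∧
      ∀ k : ℕ, ∀ x ∈ S \ Z, iteratedFDerivWithin ℝ k f S x = iteratedFDeriv ℝ k f x := by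
  classical
  set p : E → FormalMultilinearSeries ℝ E F :=
    fun x k => if x ∈ Z then 0 else iteratedFDeriv ℝ k f x with hp
  have hpZ : ∀ x ∈ Z, ∀ k, p x k = 0 := fun x hx k => by simp [hp, hx]
  have hpS : ∀ x, x ∉ Z → ∀ k, p x k = iteratedFDeriv ℝ k f x := fun x hx k => by simp [hp, hx]
  have hder : ∀ m : ℕ, ∀ x ∈ S, HasFDerivWithinAt (fun y => p y m) (p x m.succ).curryLeft S x := by
    intro m x hx
    by_cases hxZ : x ∈ Z
    · rw [hpZ x hxZ]
      obtain ⟨C, hC⟩ := hb m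
      have h0 : (0 : ContinuousMultilinearMap ℝ (fun _ : Fin m.succ => E) F).curryLeft = 0 := by
        ext; rfl
      rw [h0, hasFDerivWithinAt_iff_isLittleO, hpZ x hxZ]
      simp only [sub_zero, zero_apply]
      have hO : (fun y => p y m) =O[𝓝[S] x] fun y => ‖y - x‖ ^ 2 := by
        refine Asymptotics.IsBigO.of_bound |C| ?_
        filter_upwards [self_mem_nhdsWithin] with y hy
        by_cases hyZ : y ∈ Z
        · rw [hpZ y hyZ, norm_zero]; positivity
        · rw [hpS y hyZ, norm_pow, norm_norm]
          refine (hC y ⟨hy, hyZ⟩ x ⟨hx, hxZ⟩).trans ?_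
          gcongr
          exact le_abs_self C
      refine hO.trans_isLittleO ?_
      have : (fun y => ‖y - x‖ ^ 2) =o[𝓝 x] fun y => y - x := by
        have := (Asymptotics.isLittleO_norm_pow_id (E' := E) (n := 2) one_lt_two).comp_tendsto
          (k := fun y => y - x) (l' := 𝓝 x) (by
            have : Tendsto (fun y => y - x) (𝓝 x) (𝓝 (x - x)) :=
              (continuous_id.sub continuous_const).tendsto x
            simpa using this)
        simpa [Function.comp_def] using this
      exact this.mono nhdsWithin_le_nhds
    · rw [hpS x hxZ]
      have h1 := ((hf x ⟨hx, hxZ⟩).hasFDerivAt_iteratedFDeriv m)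
      refine HasFDerivAt.hasFDerivWithinAt (h1.congr_of_eventuallyEq ?_)
      filter_upwards [hSZ.mem_nhds ⟨hx, hxZ⟩] with y hy
      exact hpS y hy.2 m
  have hT : HasFTaylorSeriesUpToOn (⊤ : ℕ∞) f p S := by
    refine ⟨fun x hx => ?_, fun m _ x hx => hder m x hx,
      fun m _ x hx => (hder m x hx).continuousWithinAt⟩
    by_cases hxZ : x ∈ Z
    · rw [hpZ x hxZ, hf0 x ⟨hx, hxZ⟩]; rfl
    · rw [hpS x hxZ]; rfl
  have heq : ∀ k : ℕ, ∀ x ∈ S, iteratedFDerivWithin ℝ k f S x = p x k := fun k x hx =>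
    (hT.eq_iteratedFDerivWithin_of_uniqueDiffOn (by exact_mod_cast le_top) hS.uniqueDiffOn hx).symm
  exact ⟨hT.contDiffOn, fun k x hx => (heq k x hx.1).trans (hpZ x hx.2 k),
    fun k x hx => (heq k x hx.1).trans (hpS x hx.2 k)⟩

/-- Taylor estimate along a segment starting at a point where all derivatives vanish. -/
theorem norm_iteratedFDeriv_le_of_flat {E F : Type*} [NormedAddCommGroup E]
    [NormedSpace ℝ E] [NormedAddCommGroup F] [NormedSpace ℝ F] {f : E → F} {S : Set E}
    (hf : ∀ z ∈ S, ContDiffAt ℝ (⊤ : ℕ∞) f z) {G : ℕ → ℝ}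
    (hG : ∀ k : ℕ, ∀ z ∈ S, ‖iteratedFDeriv ℝ k f z‖ ≤ G k) {x y : E} (hxy : segment ℝ y x ⊆ S)
    (hy : ∀ k : ℕ, iteratedFDeriv ℝ k f y = 0) (k L : ℕ) :
    ‖iteratedFDeriv ℝ k f x‖ ≤ G (k + L) * ‖x - y‖ ^ L / (L.factorial : ℝ) := by
  have hseg : ∀ s ∈ Set.Icc (0 : ℝ) 1, y + s • (x - y) ∈ S := fun s hs => by
    apply hxy
    rw [segment_eq_image']
    exact ⟨s, hs, rfl⟩
  suffices h : ∀ L k : ℕ, ∀ s ∈ Set.Icc (0 : ℝ) 1, ‖iteratedFDeriv ℝ k f (y + s • (x - y))‖ ≤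
      G (k + L) * ‖x - y‖ ^ L * s ^ L / (L.factorial : ℝ) by
    simpa using h L k 1 (by simp)
  intro L
  induction L with
  | zero =>
    intro k s hs
    simpa using hG k _ (hseg s hs)
  | succ L ih =>
    intro k
    have hD : ∀ s ∈ Set.Icc (0 : ℝ) 1, HasDerivAt
        (fun s : ℝ => iteratedFDeriv ℝ k f (y + s • (x - y)))
        ((iteratedFDeriv ℝ (k + 1) f (y + s • (x - y))).curryLeft (x - y)) s := by
      intro s hs
      have h1 := (hf _ (hseg s hs)).hasFDerivAt_iteratedFDeriv k
      have h2 : HasDerivAt (fun s : ℝ => y + s • (x - y)) (x - y) s := by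
        simpa using ((hasDerivAt_id s).smul_const (x - y)).const_add y
      exact h1.comp_hasDerivAt s h2
    have hB : ∀ s : ℝ, HasDerivAt
        (fun s : ℝ => G (k + (L + 1)) * ‖x - y‖ ^ (L + 1) * s ^ (L + 1) / ((L + 1).factorial : ℝ))
        (G (k + (L + 1)) * ‖x - y‖ ^ (L + 1) * s ^ L / (L.factorial : ℝ)) s := by
      intro s
      have := ((hasDerivAt_pow (L + 1) s).const_mul
        (G (k + (L + 1)) * ‖x - y‖ ^ (L + 1))).div_const ((L + 1).factorial : ℝ)
      refine this.congr_deriv ?_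
      rw [Nat.factorial_succ]
      push_cast
      field_simp
    refine image_norm_le_of_norm_deriv_right_le_deriv_boundary
      (fun s hs => (hD s hs).continuousAt.continuousWithinAt)
      (fun s hs => (hD s (Set.Ico_subset_Icc_self hs)).hasDerivWithinAt) ?_ hB ?_
    · simp [hy]
    · intro s hs
      have h1 := ih (k + 1) s (Set.Ico_subset_Icc_self hs)
      refine (ContinuousLinearMap.le_opNorm _ _).trans ?_
      rw [ContinuousMultilinearMap.curryLeft_norm]
      calc _ ≤ (G (k + 1 + L) * ‖x - y‖ ^ L * s ^ L / (L.factorial : ℝ)) * ‖x - y‖ := by gcongr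
        _ = _ := by
          rw [show k + 1 + L = k + (L + 1) by ring, pow_succ]
          ring

/-- The operator norm of a multilinear form on Euclidean space is controlled by its values on
basis vectors. -/
theorem norm_le_of_apply_single_le {n k : ℕ} {F : Type*} [NormedAddCommGroup F] [NormedSpace ℝ F]
    (T : ContinuousMultilinearMap ℝ (fun _ : Fin k => EuclideanSpace ℝ (Fin n)) F) {b : ℝ}
    (hT : ∀ e : Fin k → Fin n, ‖T fun i => EuclideanSpace.single (e i) 1‖ ≤ b) (hb : 0 ≤ b) :
    ‖T‖ ≤ (n : ℝ) ^ k * b := by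
  refine ContinuousMultilinearMap.opNorm_le_bound (by positivity) fun v => ?_
  have hv : v = fun i => ∑ j : Fin n, (v i j) • (EuclideanSpace.single j (1 : ℝ)) := by
    funext i
    ext l
    simp [Finset.sum_apply, Pi.single_apply]
  calc ‖T v‖ = ‖∑ e : Fin k → Fin n, T fun i => (v i (e i)) • EuclideanSpace.single (e i) (1 : ℝ)‖ := by
        conv_lhs => rw [hv]
        rw [T.map_sum]
    _ ≤ ∑ e : Fin k → Fin n, b * ∏ i, ‖v i‖ := by
        refine norm_sum_le_of_le _ fun e _ => ?_
        rw [T.map_smul_univ, norm_smul, norm_prod, mul_comm]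
        gcongr with i _
        · exact hT e
        · exact PiLp.norm_apply_le _ _
    _ = _ := by
        simp [Finset.sum_const, Finset.card_univ]
        ring

namespace StronglyRegularWith

variable {M : ℕ → ℝ} {A : ℝ}

theorem pos (h : StronglyRegularWith M A) (j : ℕ) : 0 < M j := h.1 j

theorem zero (h : StronglyRegularWith M A) : M 0 = 1 := h.2.1

theorem one_le (h : StronglyRegularWith M A) : 1 ≤ A := h.2.2.2.2.1

theorem moderate (h : StronglyRegularWith M A) (j k : ℕ) :
    M (j + k) ≤ A ^ (j + k) * (M j * M k) := h.2.2.2.2.2.1 j k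

theorem quotient_pos (h : StronglyRegularWith M A) (j : ℕ) : 0 < M (j + 1) / M j :=
  div_pos (h.pos _) (h.pos _)

theorem monotone_quotient (h : StronglyRegularWith M A) :
    Monotone fun j : ℕ => M (j + 1) / M j := by
  refine monotone_nat_of_le_succ fun j => ?_
  rw [div_le_div_iff₀ (h.pos _) (h.pos _)]
  have := h.2.2.2.1 j
  linarith

theorem mul_le (h : StronglyRegularWith M A) (i j : ℕ) : M i * M j ≤ M (i + j) := by
  induction j with
  | zero => simp [h.zero]
  | succ j ih =>
    have h1 : M (j + 1) / M j ≤ M (i + j + 1) / M (i + j) := h.monotone_quotient (by omega)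
    rw [div_le_div_iff₀ (h.pos _) (h.pos _)] at h1
    have h2 : M i * M (j + 1) * M (i + j) ≤ M (i + j + 1) * M (i + j) :=
      calc M i * M (j + 1) * M (i + j) = M i * (M (j + 1) * M (i + j)) := by ring
        _ ≤ M i * (M (i + j + 1) * M j) := by gcongr; exact (h.pos i).le
        _ = M (i + j + 1) * (M i * M j) := by ring
        _ ≤ M (i + j + 1) * M (i + j) := by gcongr; exact (h.pos _).le
    exact le_of_mul_le_mul_right h2 (h.pos _)

theorem le_pow_mul (h : StronglyRegularWith M A) (l k N : ℕ) :
    M (N * l + k) ≤ (A ^ N) ^ (N * l + k) * (M l ^ N * M k) := by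
  have hA : 0 < A := one_pos.trans_le h.one_le
  induction N with
  | zero => simp
  | succ N ih =>
    have h1 := h.moderate l (N * l + k)
    rw [show l + (N * l + k) = (N + 1) * l + k by ring] at h1
    have hMl := h.pos l
    have hMk := h.pos k
    calc M ((N + 1) * l + k) ≤ A ^ ((N + 1) * l + k) * (M l * M (N * l + k)) := h1
      _ ≤ A ^ ((N + 1) * l + k) * (M l * ((A ^ N) ^ ((N + 1) * l + k) * (M l ^ N * M k))) := by
        gcongr
        refine ih.trans ?_
        gcongr
        · exact one_le_pow₀ h.one_le
        · omega
      _ = _ := by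
        rw [pow_succ A N, mul_pow (A ^ N) A]
        ring

theorem prod_quotient (h : StronglyRegularWith M A) (l : ℕ) :
    ∏ j ∈ Finset.range l, M (j + 1) / M j = M l := by
  induction l with
  | zero => simp [h.zero]
  | succ l ih =>
    rw [Finset.prod_range_succ, ih, mul_div_cancel₀ _ (h.pos l).ne']

theorem exists_doubling (h : StronglyRegularWith M A) :
    ∃ Q : ℕ, 2 ≤ Q ∧ ∀ l : ℕ,
      2 * (M (l + 1) / M l) ≤ M (Q * (l + 1) - 1 + 1) / M (Q * (l + 1) - 1) := by
  have hharm : ∀ (l i : ℕ), (i : ℝ) / 2 ≤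
      ∑ j ∈ Finset.range ((2 ^ i - 1) * (l + 1)), 1 / (((l + j : ℕ) : ℝ) + 1) := by
    intro l i
    induction i with
    | zero => simp
    | succ i ih =>
      have hsplit : (2 ^ (i + 1) - 1) * (l + 1) = (2 ^ i - 1) * (l + 1) + 2 ^ i * (l + 1) := by
        rw [← add_mul]
        congr 1
        have := Nat.one_le_two_pow (n := i)
        rw [pow_succ]
        omega
      rw [hsplit, Finset.sum_range_add]
      have h2 : (1 : ℝ) / 2 ≤ ∑ x ∈ Finset.range (2 ^ i * (l + 1)),
          1 / (((l + ((2 ^ i - 1) * (l + 1) + x) : ℕ) : ℝ) + 1) := by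
        have hle : ∀ x ∈ Finset.range (2 ^ i * (l + 1)), 1 / (2 * (2 ^ i * ((l : ℝ) + 1))) ≤
            1 / (((l + ((2 ^ i - 1) * (l + 1) + x) : ℕ) : ℝ) + 1) := by
          intro x hx
          rw [Finset.mem_range] at hx
          refine one_div_le_one_div_of_le (by positivity) ?_
          have h3 : l + ((2 ^ i - 1) * (l + 1) + x) + 1 ≤ 2 * (2 ^ i * (l + 1)) := by
            have h4 : (2 ^ i - 1) * (l + 1) + (l + 1) = 2 ^ i * (l + 1) := by
              rw [← Nat.succ_mul]
              congr 1
              have := Nat.one_le_two_pow (n := i)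
              omega
            omega
          exact_mod_cast h3
        refine le_trans (le_of_eq ?_) (Finset.sum_le_sum hle)
        rw [Finset.sum_const, Finset.card_range, nsmul_eq_mul]
        push_cast
        field_simp
      push_cast
      push_cast at ih h2
      linarith
  obtain ⟨i, hi⟩ := exists_nat_ge (4 * A)
  have hA := h.one_le
  have hi1 : 1 ≤ i := by
    have : (1 : ℝ) ≤ i := by linarith
    exact_mod_cast this
  refine ⟨2 ^ i, ?_, fun l => ?_⟩
  · calc 2 = 2 ^ 1 := rfl
      _ ≤ 2 ^ i := Nat.pow_le_pow_right (by norm_num) hi1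
  have hsum := h.2.2.2.2.2.2 l ((2 ^ i - 1) * (l + 1))
  set T := 2 ^ i * (l + 1) - 1 with hT
  have hmT := h.quotient_pos T
  have hml := h.quotient_pos l
  have h5 : (i : ℝ) / 2 * (M (T + 1) / M T)⁻¹ ≤ A * (M l / M (l + 1)) := by
    refine le_trans ?_ hsum
    refine (mul_le_mul_of_nonneg_right (hharm l i) (by positivity)).trans ?_
    rw [Finset.sum_mul]
    refine Finset.sum_le_sum fun j hj => ?_
    rw [Finset.mem_range] at hj
    have h6 : M (l + j + 1) / M (l + j) ≤ M (T + 1) / M T := by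
      refine h.monotone_quotient ?_
      have h4 : (2 ^ i - 1) * (l + 1) + (l + 1) = 2 ^ i * (l + 1) := by
        rw [← Nat.succ_mul]
        congr 1
        have := Nat.one_le_two_pow (n := i)
        omega
      omega
    calc 1 / (((l + j : ℕ) : ℝ) + 1) * (M (T + 1) / M T)⁻¹
        ≤ 1 / (((l + j : ℕ) : ℝ) + 1) * (M (l + j + 1) / M (l + j))⁻¹ := by
          gcongr
          exact h.quotient_pos _
      _ = _ := by
          rw [inv_div, div_mul_div_comm, one_mul]
  rw [← inv_div (M (l + 1)) (M l)] at h5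
  have h7 : 2 * A * (M (T + 1) / M T)⁻¹ ≤ A * (M (l + 1) / M l)⁻¹ := by
    refine le_trans ?_ h5
    gcongr
    linarith
  have hA0 : 0 < A := by linarith
  rw [← div_eq_mul_inv, ← div_eq_mul_inv, div_le_div_iff₀ hmT hml] at h7
  nlinarith

theorem exists_pow_growth (h : StronglyRegularWith M A) :
    ∃ (K : ℕ) (C : ℝ), 1 ≤ K ∧ 0 < C ∧ ∀ l j : ℕ, l ≤ j →
      (M (l + 1) / M l) ^ (2 * K) * ((j : ℝ) + 1) ^ 2 ≤
        C * ((l : ℝ) + 1) ^ 2 * (M (j + 1) / M j) ^ (2 * K) := by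
  obtain ⟨Q, hQ2, hQ⟩ := h.exists_doubling
  have hiter : ∀ i l j : ℕ, Q ^ i * (l + 1) ≤ j + 1 →
      2 ^ i * (M (l + 1) / M l) ≤ M (j + 1) / M j := by
    intro i
    induction i with
    | zero =>
      intro l j hj
      have hlj : l ≤ j := by simpa using hj
      simpa using h.monotone_quotient hlj
    | succ i ih =>
      intro l j hj
      have hpos : 0 < Q * (l + 1) := by positivity
      have h1 := ih (Q * (l + 1) - 1) j (by
        rw [Nat.sub_add_cancel hpos]
        calc Q ^ i * (Q * (l + 1)) = Q ^ (i + 1) * (l + 1) := by ring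
          _ ≤ j + 1 := hj)
      calc (2 : ℝ) ^ (i + 1) * (M (l + 1) / M l) = 2 ^ i * (2 * (M (l + 1) / M l)) := by ring
        _ ≤ 2 ^ i * _ := by gcongr; exact hQ l
        _ ≤ _ := h1
  refine ⟨Q, (Q : ℝ) ^ 2, by omega, by positivity, fun l j hlj => ?_⟩
  set i := Nat.log Q ((j + 1) / (l + 1)) with hi
  have hd : (j + 1) / (l + 1) ≠ 0 := (Nat.div_pos (by omega) (by omega)).ne'
  have h1 : Q ^ i * (l + 1) ≤ j + 1 :=
    (Nat.le_div_iff_mul_le (by omega)).1 (Nat.pow_log_le_self Q hd)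
  have h2 : j + 1 < Q ^ (i + 1) * (l + 1) :=
    (Nat.div_lt_iff_lt_mul (by omega)).1 (Nat.lt_pow_succ_log_self (by omega) _)
  have h3 := hiter i l j h1
  have h2' : (j : ℝ) + 1 ≤ Q ^ (i + 1) * ((l : ℝ) + 1) := by exact_mod_cast h2.le
  have hml := h.quotient_pos l
  have hQpow : (Q : ℝ) ≤ 2 ^ Q := by exact_mod_cast Nat.lt_two_pow_self.le
  calc (M (l + 1) / M l) ^ (2 * Q) * ((j : ℝ) + 1) ^ 2
      ≤ (M (l + 1) / M l) ^ (2 * Q) * (Q ^ (i + 1) * ((l : ℝ) + 1)) ^ 2 := by gcongr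
    _ = Q ^ 2 * ((l : ℝ) + 1) ^ 2 * (((Q : ℝ) ^ i) ^ 2 * (M (l + 1) / M l) ^ (2 * Q)) := by ring
    _ ≤ Q ^ 2 * ((l : ℝ) + 1) ^ 2 * ((((2 : ℝ) ^ Q) ^ i) ^ 2 * (M (l + 1) / M l) ^ (2 * Q)) := by
        gcongr
    _ = Q ^ 2 * ((l : ℝ) + 1) ^ 2 * (2 ^ i * (M (l + 1) / M l)) ^ (2 * Q) := by ring
    _ ≤ _ := by gcongr

end StronglyRegularWith

theorem Complex.norm_log_one_add_le_norm {w : ℂ} (hw : 0 ≤ w.re) : ‖Complex.log (1 + w)‖ ≤ ‖w‖ := by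
  have hs : Convex ℝ {z : ℂ | 0 ≤ z.re} := convex_halfSpace_re_ge 0
  have h := hs.norm_image_sub_le_of_norm_hasDerivWithin_le (f := fun z => Complex.log (1 + z))
    (f' := fun z => 1 / (1 + z)) (C := 1) (x := 0) (y := w) (fun z hz => ?_) (fun z hz => ?_)
    (by simp) hw
  · simpa using h
  · have hsl : 1 + z ∈ Complex.slitPlane := Or.inl (by
      have : 0 ≤ z.re := hz
      simp; linarith)
    exact (((hasDerivAt_id z).const_add 1).clog hsl).hasDerivWithinAt
  · have hz' : 0 ≤ z.re := hz
    rw [norm_div, norm_one]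
    refine div_le_one_of_le₀ ?_ (norm_nonneg _)
    refine le_trans ?_ (Complex.re_le_norm _)
    simp; linarith

/-- The logarithm of the canonical product `∏ (1 + a j * y)` on the right half-plane. -/
def logProduct (a : ℕ → ℝ) (y : ℂ) : ℂ := ∑' j, Complex.log (1 + a j * y)

theorem summable_logProduct {a : ℕ → ℝ} (ha : ∀ j, 0 ≤ a j) (hs : Summable a) {y : ℂ}
    (hy : 0 < y.re) : Summable fun j => Complex.log (1 + a j * y) := by
  refine Summable.of_norm_bounded (hs.mul_right ‖y‖) fun j => ?_
  refine (Complex.norm_log_one_add_le_norm ?_).trans ?_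
  · rw [Complex.re_ofReal_mul]
    exact mul_nonneg (ha j) hy.le
  · rw [norm_mul, Complex.norm_real, Real.norm_of_nonneg (ha j)]

theorem hasSum_re_logProduct {a : ℕ → ℝ} (ha : ∀ j, 0 ≤ a j) (hs : Summable a) {y : ℂ}
    (hy : 0 < y.re) :
    HasSum (fun j => Real.log ‖1 + a j * y‖) (logProduct a y).re := by
  have h := Complex.hasSum_re (summable_logProduct ha hs hy).hasSum
  simpa only [Complex.log_re, logProduct] using h

theorem differentiableOn_logProduct {a : ℕ → ℝ} (ha : ∀ j, 0 ≤ a j) (hs : Summable a) :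
    DifferentiableOn ℂ (logProduct a) {y : ℂ | 0 < y.re} := by
  intro y hy
  have hopen : IsOpen ({z : ℂ | 0 < z.re} ∩ Metric.ball 0 (‖y‖ + 1)) :=
    (isOpen_lt continuous_const Complex.continuous_re).inter Metric.isOpen_ball
  have h := Complex.differentiableOn_tsum_of_summable_norm
    (F := fun j z => Complex.log (1 + a j * z)) (hs.mul_right (‖y‖ + 1)) (fun j => ?_) hopen
    (fun j w hw => ?_)
  · refine (h.differentiableAt (hopen.mem_nhds ⟨hy, ?_⟩)).differentiableWithinAt
    simp
  · intro z hz
    have hz0 : 0 < z.re := hz.1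
    refine DifferentiableAt.differentiableWithinAt ?_
    refine DifferentiableAt.clog (by fun_prop) (Or.inl ?_)
    have := mul_nonneg (ha j) hz0.le
    rw [Complex.add_re, Complex.one_re, Complex.re_ofReal_mul]
    linarith
  · refine (Complex.norm_log_one_add_le_norm ?_).trans ?_
    · rw [Complex.re_ofReal_mul]
      exact mul_nonneg (ha j) (le_of_lt hw.1)
    · rw [norm_mul, Complex.norm_real, Real.norm_of_nonneg (ha j)]
      have := ha j
      gcongr
      exact (mem_ball_zero_iff.1 hw.2).le

/-- On a thin sector around the positive axis, `t ^ (2 * K) * z ^ (-K)` stays close to `1`. -/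
theorem exists_ball_norm_inv_pow_sub_one_le (K : ℕ) :
    ∃ c : ℝ, 0 < c ∧ c < 1 ∧ ∀ t : ℝ, 0 < t → ∀ z ∈ Metric.closedBall ((t ^ 2 : ℝ) : ℂ) (c * t ^ 2),
      z ≠ 0 ∧ ‖((t ^ (2 * K) : ℝ) : ℂ) * (z ^ K)⁻¹ - 1‖ ≤ 1 / 2 := by
  have hcont : ContinuousAt (fun z : ℂ => (z ^ K)⁻¹) 1 :=
    (continuousAt_id.pow K).inv₀ (by simp)
  obtain ⟨d, hd0, hd⟩ := Metric.continuousAt_iff.1 hcont (1 / 2) (by norm_num)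
  refine ⟨min (d / 2) (1 / 2), by positivity, ?_, fun t ht z hz => ?_⟩
  · exact (min_le_right _ _).trans_lt (by norm_num)
  have ht2 : ((t ^ 2 : ℝ) : ℂ) ≠ 0 := by exact_mod_cast (pow_pos ht 2).ne'
  have hw : dist (z / ((t ^ 2 : ℝ) : ℂ)) 1 ≤ min (d / 2) (1 / 2) := by
    rw [dist_eq_norm, div_sub_one ht2, norm_div, Complex.norm_real,
      Real.norm_of_nonneg (by positivity), div_le_iff₀ (by positivity), ← dist_eq_norm]
    exact hz
  constructor
  · rintro rfl
    rw [zero_div, dist_zero_left, norm_one] at hw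
    have := hw.trans (min_le_right _ _)
    norm_num at this
  · have h1 := hd (hw.trans_lt ((min_le_left _ _).trans_lt (by linarith)))
    rw [dist_eq_norm] at h1
    simp only [one_pow, inv_one] at h1
    refine le_trans (le_of_eq ?_) h1.le
    congr 2
    rw [div_pow, inv_div, pow_mul, div_eq_mul_inv]
    push_cast
    ring

theorem sum_inv_sq_le (l n : ℕ) :
    ∑ j ∈ Finset.range n, 1 / (((l + j : ℕ) : ℝ) + 1) ^ 2 ≤
      2 / ((l : ℝ) + 1) - 2 / ((l : ℝ) + n + 1) := by
  induction n with
  | zero => simp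
  | succ n ih =>
    rw [Finset.sum_range_succ]
    have : 1 / (((l + n : ℕ) : ℝ) + 1) ^ 2 ≤
        2 / ((l : ℝ) + n + 1) - 2 / ((l : ℝ) + (n + 1 : ℕ) + 1) := by
      push_cast
      have h1 : 0 < (l : ℝ) + n + 1 := by positivity
      have h2 : 0 < (l : ℝ) + (n + 1) + 1 := by positivity
      rw [div_sub_div _ _ h1.ne' h2.ne', div_le_div_iff₀ (by positivity) (by positivity)]
      have h3 : 0 ≤ (l : ℝ) + n := by positivity
      nlinarith [sq_nonneg ((l : ℝ) + n + 1)]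
    linarith

theorem StronglyRegularWith.exists_flat_holomorphic {M : ℕ → ℝ} {A : ℝ}
    (h : StronglyRegularWith M A) :
    ∃ (N : ℕ) (c C b : ℝ), 1 ≤ N ∧ 0 < c ∧ 0 < C ∧ 0 < b ∧ ∀ B : ℝ, 0 < B → ∃ Φ : ℂ → ℂ,
      ∀ t : ℝ, 0 < t →
        DifferentiableOn ℂ Φ (Metric.closedBall ((t ^ 2 : ℝ) : ℂ) (c * t ^ 2)) ∧
        (∀ z ∈ Metric.closedBall ((t ^ 2 : ℝ) : ℂ) (c * t ^ 2),
          1 ≤ ‖Φ z‖ ∧ ∀ k, 1 ≤ ‖Φ z‖ * ((2 * B * t) ^ k * M k) ^ N) ∧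
        ∃ l, ∀ z ∈ Metric.closedBall ((t ^ 2 : ℝ) : ℂ) (c * t ^ 2),
          ‖Φ z‖ * ((b * B * t) ^ l * M l) ^ N ≤ C := by
  obtain ⟨K, D, hK, hD, hgrow⟩ := h.exists_pow_growth
  obtain ⟨c, hc0, hc1, hc⟩ := exists_ball_norm_inv_pow_sub_one_le K
  set m : ℕ → ℝ := fun j => M (j + 1) / M j with hm
  have hmpos : ∀ j, 0 < m j := h.quotient_pos
  set N := 2 * K with hN
  have hN1 : 1 ≤ N := by omega
  set b : ℝ := (3 * Real.exp (4 * D))⁻¹ with hb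
  have hb0 : 0 < b := by positivity
  refine ⟨N, c, Real.exp (4 * D), b, hN1, hc0, by positivity, hb0, fun B hB => ?_⟩
  set a : ℕ → ℝ := fun j => ((B * m j) ^ N)⁻¹ with ha
  have hapos : ∀ j, 0 < a j := fun j => by have := hmpos j; positivity
  have hratio : ∀ l j, l ≤ j → a j ≤ D * ((l : ℝ) + 1) ^ 2 * (1 / ((j : ℝ) + 1) ^ 2) * a l := by
    intro l j hlj
    have h1 := hgrow l j hlj
    have hl := hmpos l
    have hj := hmpos j
    have h1' : m l ^ N * ((j : ℝ) + 1) ^ 2 ≤ D * ((l : ℝ) + 1) ^ 2 * m j ^ N := h1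
    simp only [ha, mul_pow]
    rw [inv_le_iff_one_le_mul₀ (by positivity)]
    have : D * ((l : ℝ) + 1) ^ 2 * (1 / ((j : ℝ) + 1) ^ 2) * (B ^ N * m l ^ N)⁻¹ *
        (B ^ N * m j ^ N) = (D * ((l : ℝ) + 1) ^ 2 * m j ^ N) / (m l ^ N * ((j : ℝ) + 1) ^ 2) := by
      field_simp
    rw [this, one_le_div (by positivity)]
    exact h1'
  have hsq : Summable fun j : ℕ => 1 / ((j : ℝ) + 1) ^ 2 := by
    have := (summable_nat_add_iff 1).2 (Real.summable_one_div_nat_pow.2 (one_lt_two))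
    simpa using this
  have hasum : Summable a := by
    refine Summable.of_nonneg_of_le (fun j => (hapos j).le) (fun j => hratio 0 j (Nat.zero_le j)) ?_
    exact (hsq.mul_left _).mul_right _
  have hatend : Tendsto a atTop (𝓝 0) := hasum.tendsto_atTop_zero
  refine ⟨fun z => Complex.exp (logProduct a ((z ^ K)⁻¹)), fun t ht => ?_⟩
  set x : ℕ → ℝ := fun j => ((B * m j * t) ^ N)⁻¹ with hx
  have hxpos : ∀ j, 0 < x j := fun j => by have := hmpos j; positivity
  have hxa : ∀ j, x j = a j * (t ^ N)⁻¹ := fun j => by simp only [hx, ha, mul_pow, mul_inv]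
  have htN : 0 < t ^ N := by positivity
  have hkey : ∀ z ∈ Metric.closedBall ((t ^ 2 : ℝ) : ℂ) (c * t ^ 2),
      0 < ((z ^ K)⁻¹).re ∧ ∀ j, 1 + x j / 2 ≤ ‖1 + a j * (z ^ K)⁻¹‖ ∧
        ‖1 + a j * (z ^ K)⁻¹‖ ≤ 1 + 2 * x j := by
    intro z hz
    obtain ⟨hz0, hz1⟩ := hc t ht z hz
    set η : ℂ := ((t ^ N : ℝ) : ℂ) * (z ^ K)⁻¹ with hη
    have hy : (z ^ K)⁻¹ = (((t ^ N)⁻¹ : ℝ) : ℂ) * η := by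
      rw [hη, ← mul_assoc, ← Complex.ofReal_mul, inv_mul_cancel₀ htN.ne', Complex.ofReal_one,
        one_mul]
    have hre : 1 / 2 ≤ η.re := by
      have h1 : |(η - 1).re| ≤ 1 / 2 := (Complex.abs_re_le_norm _).trans hz1
      rw [Complex.sub_re, Complex.one_re] at h1
      have := (abs_le.1 h1).1
      linarith
    have hnorm : ‖η‖ ≤ 2 := by
      calc ‖η‖ = ‖(η - 1) + 1‖ := by ring_nf
        _ ≤ ‖η - 1‖ + ‖(1 : ℂ)‖ := norm_add_le _ _
        _ ≤ 2 := by rw [norm_one]; linarith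
    refine ⟨?_, fun j => ?_⟩
    · rw [hy, Complex.re_ofReal_mul]
      have : 0 < η.re := by linarith
      positivity
    · have haj : (a j : ℂ) * (z ^ K)⁻¹ = (x j : ℂ) * η := by
        rw [hy, hxa, Complex.ofReal_mul, mul_assoc]
      have hxj := hxpos j
      rw [haj]
      constructor
      · refine le_trans ?_ (Complex.re_le_norm _)
        rw [Complex.add_re, Complex.one_re, Complex.re_ofReal_mul]
        nlinarith
      · refine (norm_add_le _ _).trans ?_
        rw [norm_one, norm_mul, Complex.norm_real, Real.norm_of_nonneg hxj.le]
        nlinarith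
  have hprodx : ∀ k, (∏ j ∈ Finset.range k, x j) * ((B * t) ^ k * M k) ^ N = 1 := by
    intro k
    have h1 : ∏ j ∈ Finset.range k, x j = (((B * t) ^ k * M k) ^ N)⁻¹ := by
      rw [← h.prod_quotient k]
      simp only [hx, hm]
      rw [Finset.prod_inv_distrib, Finset.prod_pow]
      congr 2
      rw [← Finset.card_range k, ← Finset.prod_const, Finset.card_range, ← Finset.prod_mul_distrib]
      exact Finset.prod_congr rfl fun j _ => by ring
    rw [h1]
    have := h.pos k
    exact inv_mul_cancel₀ (by positivity)
  refine ⟨?_, fun z hz => ?_, ?_⟩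
  · refine DifferentiableOn.cexp ?_
    refine (differentiableOn_logProduct (fun j => (hapos j).le) hasum).comp ?_
      (fun z hz => (hkey z hz).1)
    intro z hz
    exact ((differentiableAt_id.pow K).inv (pow_ne_zero _ (hc t ht z hz).1)).differentiableWithinAt
  · obtain ⟨hre, hb1⟩ := hkey z hz
    have hS := hasSum_re_logProduct (fun j => (hapos j).le) hasum hre
    have hnn : ∀ j, 0 ≤ Real.log ‖1 + a j * (z ^ K)⁻¹‖ := fun j =>
      Real.log_nonneg (by have := (hb1 j).1; have := hxpos j; linarith)
    simp only [Complex.norm_exp]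
    refine ⟨Real.one_le_exp (hS.nonneg hnn), fun k => ?_⟩
    have h1 : ∏ j ∈ Finset.range k, x j / 2 ≤ Real.exp (logProduct a ((z ^ K)⁻¹)).re := by
      refine le_trans ?_ (Real.exp_le_exp.2 (sum_le_hasSum (Finset.range k) (fun j _ => hnn j) hS))
      rw [Real.exp_sum]
      refine Finset.prod_le_prod (fun j _ => by have := hxpos j; positivity) fun j _ => ?_
      have := (hb1 j).1
      have := hxpos j
      rw [Real.exp_log (by linarith)]
      linarith
    have hMk := h.pos k
    have h2 := hprodx k
    rw [Finset.prod_div_distrib, Finset.prod_const, Finset.card_range] at h1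
    calc (1 : ℝ) ≤ (2 ^ k) ^ (N - 1) := one_le_pow₀ (one_le_pow₀ one_le_two)
      _ = (2 ^ k) ^ (N - 1) * ((∏ j ∈ Finset.range k, x j) * ((B * t) ^ k * M k) ^ N) := by
        rw [h2, mul_one]
      _ = (∏ j ∈ Finset.range k, x j) / 2 ^ k * ((2 * B * t) ^ k * M k) ^ N := by
        have : (2 * B * t) ^ k * M k = 2 ^ k * ((B * t) ^ k * M k) := by ring
        rw [this, mul_pow (2 ^ k) _ N]
        obtain ⟨N', hN'⟩ : ∃ N', N = N' + 1 := ⟨N - 1, by omega⟩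
        rw [hN', Nat.add_sub_cancel, pow_succ (2 ^ k : ℝ) N']
        field_simp
      _ ≤ _ := by gcongr
  · have hex : ∃ j, x j ≤ 1 := by
      have h1 : Tendsto x atTop (𝓝 0) := by
        simp only [funext hxa]
        simpa using hatend.mul_const (t ^ N)⁻¹
      exact (h1.eventually_le_const one_pos).exists
    classical
    set l := Nat.find hex with hl
    have hxl : x l ≤ 1 := Nat.find_spec hex
    have hxlt : ∀ j < l, 1 ≤ x j := fun j hj => (not_le.1 (Nat.find_min hex hj)).le
    have hxge : ∀ j, x (l + j) ≤ D * ((l : ℝ) + 1) ^ 2 * (1 / (((l + j : ℕ) : ℝ) + 1) ^ 2) := by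
      intro j
      have h1 := hratio l (l + j) (Nat.le_add_right _ _)
      calc x (l + j) = a (l + j) * (t ^ N)⁻¹ := hxa _
        _ ≤ D * ((l : ℝ) + 1) ^ 2 * (1 / (((l + j : ℕ) : ℝ) + 1) ^ 2) * a l * (t ^ N)⁻¹ := by
          gcongr
        _ = D * ((l : ℝ) + 1) ^ 2 * (1 / (((l + j : ℕ) : ℝ) + 1) ^ 2) * x l := by rw [hxa]; ring
        _ ≤ _ := mul_le_of_le_one_right (by positivity) hxl
    refine ⟨l, fun z hz => ?_⟩
    obtain ⟨hre, hb1⟩ := hkey z hz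
    have hS := hasSum_re_logProduct (fun j => (hapos j).le) hasum hre
    have hpos1 : ∀ j, 0 < ‖1 + a j * (z ^ K)⁻¹‖ := fun j => by
      have := (hb1 j).1; have := hxpos j; linarith
    have hpartial : ∀ n, ∑ j ∈ Finset.range (l + n), Real.log ‖1 + a j * (z ^ K)⁻¹‖ ≤
        ∑ j ∈ Finset.range l, Real.log (3 * x j) + 4 * D * (l + 1) := by
      intro n
      rw [Finset.sum_range_add]
      refine add_le_add (Finset.sum_le_sum fun j hj => ?_) ?_
      · refine Real.log_le_log (hpos1 j) ((hb1 j).2.trans ?_)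
        have := hxlt j (Finset.mem_range.1 hj)
        linarith
      · calc ∑ j ∈ Finset.range n, Real.log ‖1 + a (l + j) * (z ^ K)⁻¹‖
            ≤ ∑ j ∈ Finset.range n,
              2 * (D * ((l : ℝ) + 1) ^ 2 * (1 / (((l + j : ℕ) : ℝ) + 1) ^ 2)) := by
              refine Finset.sum_le_sum fun j _ => ?_
              have h1 := Real.log_le_sub_one_of_pos (hpos1 (l + j))
              have h2 := (hb1 (l + j)).2
              have h3 := hxge j
              linarith
          _ = 2 * (D * ((l : ℝ) + 1) ^ 2) *
              ∑ j ∈ Finset.range n, 1 / (((l + j : ℕ) : ℝ) + 1) ^ 2 := by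
              rw [Finset.mul_sum]
              exact Finset.sum_congr rfl fun j _ => by ring
          _ ≤ 2 * (D * ((l : ℝ) + 1) ^ 2) * (2 / ((l : ℝ) + 1)) := by
              gcongr
              have h1 := sum_inv_sq_le l n
              have h2 : 0 ≤ 2 / ((l : ℝ) + n + 1) := by positivity
              linarith
          _ = 4 * D * (l + 1) := by field_simp; ring
    have hlim : (logProduct a ((z ^ K)⁻¹)).re ≤
        ∑ j ∈ Finset.range l, Real.log (3 * x j) + 4 * D * (l + 1) := by
      have h1 := hS.tendsto_sum_nat.comp (tendsto_add_atTop_nat l)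
      refine le_of_tendsto' h1 fun n => ?_
      have := hpartial n
      rw [add_comm l n] at this
      exact this
    have hMl := h.pos l
    have hexp : ‖Complex.exp (logProduct a ((z ^ K)⁻¹))‖ ≤
        (3 ^ l * ∏ j ∈ Finset.range l, x j) * (Real.exp (4 * D) * Real.exp (4 * D) ^ l) := by
      rw [Complex.norm_exp]
      refine (Real.exp_le_exp.2 hlim).trans (le_of_eq ?_)
      rw [Real.exp_add, Real.exp_sum]
      congr 1
      · rw [Finset.prod_congr rfl fun j _ => Real.exp_log (by have := hxpos j; positivity),
          Finset.prod_mul_distrib, Finset.prod_const, Finset.card_range]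
      · rw [← Real.exp_nat_mul, ← Real.exp_add]
        congr 1
        ring
    have hbN : (b ^ l) ^ N * (3 * Real.exp (4 * D)) ^ l ≤ 1 := by
      have hb1 : b ^ l ≤ 1 := by
        refine pow_le_one₀ hb0.le ?_
        rw [hb]
        refine inv_le_one_of_one_le₀ ?_
        have := Real.one_le_exp (show 0 ≤ 4 * D by positivity)
        linarith
      calc (b ^ l) ^ N * (3 * Real.exp (4 * D)) ^ l
          ≤ (b ^ l) ^ 1 * (3 * Real.exp (4 * D)) ^ l := by
            gcongr ?_ * _
            exact pow_le_pow_of_le_one (by positivity) hb1 hN1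
        _ = 1 := by
            rw [pow_one, ← mul_pow, hb, inv_mul_cancel₀ (by positivity), one_pow]
    calc ‖Complex.exp (logProduct a ((z ^ K)⁻¹))‖ * ((b * B * t) ^ l * M l) ^ N
        ≤ (3 ^ l * ∏ j ∈ Finset.range l, x j) * (Real.exp (4 * D) * Real.exp (4 * D) ^ l) *
          ((b * B * t) ^ l * M l) ^ N := by gcongr
      _ = Real.exp (4 * D) * ((b ^ l) ^ N * (3 * Real.exp (4 * D)) ^ l) *
          ((∏ j ∈ Finset.range l, x j) * ((B * t) ^ l * M l) ^ N) := by
        have : (b * B * t) ^ l * M l = b ^ l * ((B * t) ^ l * M l) := by ring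
        rw [this, mul_pow (b ^ l) _ N, mul_pow (3 : ℝ)]
        ring
      _ ≤ Real.exp (4 * D) * 1 * 1 := by
        rw [hprodx l]
        gcongr
      _ = Real.exp (4 * D) := by ring

/-- Near a point, an analytic submanifold is the zero set of a nonnegative analytic function
comparable to the square of the distance to the submanifold. -/
theorem IsAnalyticSubmanifold.exists_sq_dist_function {n : ℕ}
    {X Ω : Set (EuclideanSpace ℝ (Fin n))} (hX : IsAnalyticSubmanifold X) (hΩ : IsOpen Ω)
    (h0 : (0 : EuclideanSpace ℝ (Fin n)) ∈ X) (h0Ω : (0 : EuclideanSpace ℝ (Fin n)) ∈ Ω) :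
    ∃ (q : EuclideanSpace ℝ (Fin n) → ℝ) (ρ L : ℝ), 0 < ρ ∧ 0 < L ∧ AnalyticAt ℝ q 0 ∧
      Metric.ball 0 ρ ⊆ Ω ∧ ∀ x ∈ Metric.ball (0 : EuclideanSpace ℝ (Fin n)) ρ,
        0 ≤ q x ∧ q x ≤ 1 ∧ ContinuousAt q x ∧ (q x = 0 ↔ x ∈ X) ∧
        ‖fderiv ℝ q x‖ ≤ L * √(q x) ∧
        (∃ y ∈ X, ‖x - y‖ ≤ L * √(q x) ∧ segment ℝ y x ⊆ Ω) ∧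
        ∀ y ∈ Metric.ball (0 : EuclideanSpace ℝ (Fin n)) ρ, y ∈ X → √(q x) ≤ L * ‖x - y‖ := by
  obtain ⟨U, W, φ, ψ, V, hU, h0U, hW, hφ, hψ, hφm, hψm, hψφ, hφψ, himg⟩ := hX 0 h0
  set P := V.starProjection with hP
  set g : EuclideanSpace ℝ (Fin n) → EuclideanSpace ℝ (Fin n) := fun x => φ x - P (φ x) with hg
  have hga : AnalyticAt ℝ g 0 := (hφ 0 h0U).sub ((P.analyticAt _).comp (hφ 0 h0U))
  have hXg : ∀ x ∈ U, g x = 0 ↔ x ∈ X := by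
    intro x hx
    have h1 : g x = 0 ↔ φ x ∈ V := by
      rw [hg, sub_eq_zero, eq_comm]
      exact Submodule.starProjection_eq_self_iff
    rw [h1]
    constructor
    · intro h2
      have h3 : φ x ∈ φ '' (X ∩ U) := by rw [himg]; exact ⟨h2, hφm hx⟩
      obtain ⟨x', ⟨hx'X, hx'U⟩, hxx'⟩ := h3
      have : x' = x := by rw [← hψφ x' hx'U, hxx', hψφ x hx]
      exact this ▸ hx'X
    · intro h2
      have h3 : φ x ∈ φ '' (X ∩ U) := ⟨x, ⟨h2, hx⟩, rfl⟩
      rw [himg] at h3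
      exact h3.1
  have hg0 : g 0 = 0 := (hXg 0 h0U).2 h0
  have hP0 : P (φ 0) = φ 0 := (sub_eq_zero.1 hg0).symm
  obtain ⟨ε, hε, hεΩ⟩ := Metric.isOpen_iff.1 hΩ 0 h0Ω
  obtain ⟨K₁, s, hs, hsL⟩ := ((hψ _ (hφm h0U)).contDiffAt (n := 1)).exists_lipschitzOnWith
  obtain ⟨K₂, s', hs', hsL'⟩ := (hga.contDiffAt (n := 1)).exists_lipschitzOnWith
  have hφc : ContinuousAt φ 0 := (hφ 0 h0U).continuousAt
  have hPφc : Tendsto (fun x => P (φ x)) (𝓝 0) (𝓝 (φ 0)) := by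
    have : Tendsto (fun x => P (φ x)) (𝓝 0) (𝓝 (P (φ 0))) := P.continuous.continuousAt.tendsto.comp hφc
    rwa [hP0] at this
  have hψc : ContinuousAt ψ (φ 0) := (hψ _ (hφm h0U)).continuousAt
  have hψε : ∀ᶠ y in 𝓝 (φ 0), ψ y ∈ Metric.ball 0 ε := by
    have : ψ (φ 0) = 0 := hψφ 0 h0U
    refine hψc.eventually_mem ?_
    rw [this]
    exact Metric.ball_mem_nhds _ hε
  have hgd : ∀ᶠ x in 𝓝 (0 : EuclideanSpace ℝ (Fin n)), DifferentiableAt ℝ g x := by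
    filter_upwards [hga.eventually_analyticAt] with x hx using hx.differentiableAt
  have hfd : ∀ᶠ x in 𝓝 (0 : EuclideanSpace ℝ (Fin n)), ‖fderiv ℝ g x‖ < ‖fderiv ℝ g 0‖ + 1 :=
    hga.fderiv.continuousAt.norm.eventually_lt_const (by linarith)
  have hg1 : ∀ᶠ x in 𝓝 (0 : EuclideanSpace ℝ (Fin n)), ‖g x‖ < 1 :=
    hga.continuousAt.norm.eventually_lt_const (by simp [hg0])
  have hall : ∀ᶠ x in 𝓝 (0 : EuclideanSpace ℝ (Fin n)), x ∈ U ∧ x ∈ Metric.ball 0 ε ∧ x ∈ s' ∧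
      φ x ∈ s ∧ (P (φ x) ∈ s ∧ P (φ x) ∈ W ∧ ψ (P (φ x)) ∈ Metric.ball 0 ε) ∧
      DifferentiableAt ℝ g x ∧ ‖fderiv ℝ g x‖ < ‖fderiv ℝ g 0‖ + 1 ∧ ‖g x‖ < 1 := by
    filter_upwards [hU.mem_nhds h0U, Metric.ball_mem_nhds _ hε, hs', hφc.eventually_mem hs,
      hPφc.eventually_mem hs, hPφc.eventually_mem (hW.mem_nhds (hφm h0U)), hPφc.eventually hψε,
      hgd, hfd, hg1] with x h1 h2 h3 h4 h5 h6 h7 h8 h9 h10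
    exact ⟨h1, h2, h3, h4, ⟨h5, h6, h7⟩, h8, h9, h10⟩
  obtain ⟨ρ, hρ, hball⟩ := Metric.eventually_nhds_iff_ball.1 hall
  have hsqrt : ∀ x, √(‖g x‖ ^ 2) = ‖g x‖ := fun x => Real.sqrt_sq (norm_nonneg _)
  set L : ℝ := K₁ + K₂ + 2 * (‖fderiv ℝ g 0‖ + 1) with hL
  have hLK₁ : (K₁ : ℝ) ≤ L := by have := K₂.coe_nonneg; have := norm_nonneg (fderiv ℝ g 0); linarith
  have hLK₂ : (K₂ : ℝ) ≤ L := by have := K₁.coe_nonneg; have := norm_nonneg (fderiv ℝ g 0); linarith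
  have hLd : 2 * (‖fderiv ℝ g 0‖ + 1) ≤ L := by
    have := K₁.coe_nonneg; have := K₂.coe_nonneg; linarith
  refine ⟨fun x => ‖g x‖ ^ 2, ρ, L, hρ, ?_, ?_, ?_, ?_⟩
  · have := norm_nonneg (fderiv ℝ g 0); linarith
  · simp only [EuclideanSpace.norm_sq_eq, Real.norm_eq_abs, sq_abs]
    refine Finset.analyticAt_fun_sum _ fun i _ => ?_
    have hproj : AnalyticAt ℝ (EuclideanSpace.proj i : EuclideanSpace ℝ (Fin n) →L[ℝ] ℝ) (g 0) :=
      ContinuousLinearMap.analyticAt _ _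
    exact (hproj.comp hga).pow 2
  · exact fun x hx => hεΩ (hball x hx).2.1
  intro x hx
  obtain ⟨hxU, hxε, hxs', hxs, ⟨hPs, hPW, hψP⟩, hxd, hxf, hx1⟩ := hball x hx
  simp only [hsqrt]
  refine ⟨by positivity, pow_le_one₀ (norm_nonneg _) hx1.le, hxd.continuousAt.norm.pow 2,
    ?_, ?_, ?_, ?_⟩
  · rw [sq_eq_zero_iff, norm_eq_zero]
    exact hXg x hxU
  · rw [hxd.hasFDerivAt.norm_sq.fderiv]
    calc _ ≤ 2 * (‖g x‖ * ‖fderiv ℝ g x‖) := by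
          refine (norm_nsmul_le).trans ?_
          simp only [Nat.cast_ofNat]
          gcongr
          refine (ContinuousLinearMap.opNorm_comp_le _ _).trans ?_
          rw [innerSL_apply_norm]
      _ ≤ 2 * (‖g x‖ * (‖fderiv ℝ g 0‖ + 1)) := by gcongr
      _ = 2 * (‖fderiv ℝ g 0‖ + 1) * ‖g x‖ := by ring
      _ ≤ L * ‖g x‖ := by gcongr
  · have hmem : P (φ x) ∈ φ '' (X ∩ U) := by
      rw [himg]
      exact ⟨Submodule.starProjection_apply_mem _ _, hPW⟩
    obtain ⟨y, ⟨hyX, hyU⟩, hy⟩ := hmem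
    have hyψ : ψ (P (φ x)) = y := by rw [← hy, hψφ y hyU]
    refine ⟨y, hyX, ?_, ?_⟩
    · have h1 := hsL.norm_sub_le hxs hPs
      rw [hψφ x hxU, hyψ] at h1
      exact h1.trans (by gcongr)
    · refine ((convex_ball (0 : EuclideanSpace ℝ (Fin n)) ε).segment_subset ?_ hxε).trans hεΩ
      exact hyψ ▸ hψP
  · intro y hy hyX
    obtain ⟨hyU, -, hys', -⟩ := hball y hy
    have h1 := hsL'.norm_sub_le hxs' hys'
    rw [(hXg y hyU).2 hyX, sub_zero] at h1
    exact h1.trans (by gcongr)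

/-- A scale-invariant bound on the power series of a function whose gradient is controlled by its
square root. -/
theorem exists_norm_powerSeries_le_div_pow {E : Type*} [NormedAddCommGroup E] [NormedSpace ℝ E]
    (q : E → ℝ) {c L ρ C : ℝ} (hc : 0 < c) (hL : 0 < L) (hρ : 0 < ρ) (hC : 0 < C) :
    ∃ δ, 0 < δ ∧ ∀ (x : E) (p : FormalMultilinearSeries ℝ E ℝ), 0 < q x → q x ≤ 1 →
      HasFPowerSeriesAt q p x → ‖fderiv ℝ q x‖ ≤ L * √(q x) → (∀ k, ‖p k‖ ≤ C / ρ ^ k) →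
      ∀ k, 1 ≤ k → ‖p k‖ ≤ c * q x / (δ * √(q x)) ^ k := by
  set θ := min 1 (c / C) with hθ
  have hθ0 : 0 < θ := lt_min one_pos (div_pos hc hC)
  refine ⟨min (c / L) (ρ * θ), lt_min (div_pos hc hL) (mul_pos hρ hθ0), ?_⟩
  intro x p hx hx1 hp hd hk k hk1
  set δ := min (c / L) (ρ * θ) with hδ
  have hδ0 : 0 < δ := lt_min (div_pos hc hL) (mul_pos hρ hθ0)
  set t := √(q x) with ht
  have ht0 : 0 < t := Real.sqrt_pos.2 hx
  have ht1 : t ≤ 1 := Real.sqrt_le_one.2 hx1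
  have htt : q x = t ^ 2 := (Real.sq_sqrt hx.le).symm
  rw [htt, le_div_iff₀ (by positivity)]
  obtain rfl | hk2 := hk1.eq_or_lt
  · have h1 : ‖p 1‖ = ‖fderiv ℝ q x‖ := by
      rw [hp.fderiv_eq, LinearIsometryEquiv.norm_map]
    rw [h1, pow_one]
    have h2 : δ * L ≤ c := (le_div_iff₀ hL).1 (min_le_left _ _)
    calc _ ≤ L * t * (δ * t) := by gcongr
      _ = δ * L * t ^ 2 := by ring
      _ ≤ c * t ^ 2 := by gcongr
  · have h1 : δ ^ k ≤ ρ ^ k * (c / C) := by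
      calc δ ^ k ≤ (ρ * θ) ^ k := by gcongr; exact min_le_right _ _
        _ = ρ ^ k * θ ^ k := mul_pow _ _ _
        _ ≤ ρ ^ k * θ := by
            gcongr
            exact pow_le_of_le_one hθ0.le (min_le_left _ _) (by omega)
        _ ≤ _ := by gcongr; exact min_le_right _ _
    calc _ ≤ C / ρ ^ k * (δ * t) ^ k := by gcongr; exact hk k
      _ = C / ρ ^ k * δ ^ k * t ^ k := by rw [mul_pow]; ring
      _ ≤ C / ρ ^ k * (ρ ^ k * (c / C)) * t ^ 2 := by
          gcongr 1
          · gcongr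
          · exact pow_le_pow_of_le_one ht0.le ht1 hk2
      _ = c * t ^ 2 := by field_simp

theorem norm_mixedPartial_le {n : ℕ} {F : Type*} [NormedAddCommGroup F] [NormedSpace ℝ F]
    (S : Set (EuclideanSpace ℝ (Fin n))) (f : EuclideanSpace ℝ (Fin n) → F)
    (k : ℕ) (e : Fin k → Fin n) (x : EuclideanSpace ℝ (Fin n)) :
    ‖mixedPartial S f k e x‖ ≤ ‖iteratedFDerivWithin ℝ k f S x‖ := by
  refine (ContinuousMultilinearMap.le_opNorm _ _).trans ?_
  simp

theorem ClassCMOn.exists_norm_iteratedFDeriv_le {n : ℕ} {M : ℕ → ℝ}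
    {S : Set (EuclideanSpace ℝ (Fin n))} {f : EuclideanSpace ℝ (Fin n) → ℂ}
    (hf : ClassCMOn M S f) (hM : ∀ j, 0 < M j) (hS : IsOpen S) :
    ∃ C σ : ℝ, 0 < C ∧ 0 < σ ∧ ∀ k, ∀ x ∈ S,
      ‖iteratedFDeriv ℝ k f x‖ ≤ C * σ ^ k * (k.factorial : ℝ) * M k := by
  obtain ⟨-, C, σ, hC, hσ, h⟩ := hf
  refine ⟨C, (n + 1) * σ, hC, by positivity, fun k x hx => ?_⟩
  rw [← iteratedFDerivWithin_of_isOpen k hS hx]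
  have hM' := hM k
  refine (norm_le_of_apply_single_le _ (fun e => h k e x hx) (by positivity)).trans ?_
  rw [mul_pow]
  calc (n : ℝ) ^ k * (C * σ ^ k * (k.factorial : ℝ) * M k)
      ≤ ((n : ℝ) + 1) ^ k * (C * σ ^ k * (k.factorial : ℝ) * M k) := by gcongr; simp
    _ = _ := by ring

theorem FlatOn.iteratedFDeriv_eq_zero {n : ℕ} {S X : Set (EuclideanSpace ℝ (Fin n))}
    {f : EuclideanSpace ℝ (Fin n) → ℂ} (hf : FlatOn S X f) (hS : IsOpen S)
    {x : EuclideanSpace ℝ (Fin n)} (hx : x ∈ X) (hxS : x ∈ S) (k : ℕ) :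
    iteratedFDeriv ℝ k f x = 0 := by
  rw [← iteratedFDerivWithin_of_isOpen k hS hxS, ← norm_le_zero_iff]
  refine (norm_le_of_apply_single_le _ (b := 0) (fun e => ?_) le_rfl).trans (by simp)
  exact (norm_eq_zero.2 (hf x hx k e)).le

theorem FlatOn.eq_zero {n : ℕ} {S X : Set (EuclideanSpace ℝ (Fin n))}
    {f : EuclideanSpace ℝ (Fin n) → ℂ} (hf : FlatOn S X f)
    {x : EuclideanSpace ℝ (Fin n)} (hx : x ∈ X) : f x = 0 := by
  simpa [mixedPartial] using hf x hx 0 Fin.elim0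

/-- Taylor estimate for the derivatives of a function of class `C_M` near a point where it is
flat. -/
theorem StronglyRegularWith.norm_iteratedFDeriv_le_of_flat {E F : Type*} [NormedAddCommGroup E]
    [NormedSpace ℝ E] [NormedAddCommGroup F] [NormedSpace ℝ F] {M : ℕ → ℝ} {A : ℝ}
    (h : StronglyRegularWith M A) {S : Set E} {f : E → F}
    (hf : ∀ z ∈ S, ContDiffAt ℝ (⊤ : ℕ∞) f z) {C σ L t s : ℝ} (hC : 0 < C) (hσ : 0 < σ)
    (hfb : ∀ k, ∀ x ∈ S, ‖iteratedFDeriv ℝ k f x‖ ≤ C * σ ^ k * (k.factorial : ℝ) * M k)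
    {x y : E} (hxy : segment ℝ y x ⊆ S) (hy : ∀ k, iteratedFDeriv ℝ k f y = 0)
    (ht : 0 ≤ t) (hs : 2 * σ * A ≤ s) (hsL : 2 * σ * A * L ≤ s) (hxyt : ‖x - y‖ ≤ L * t) (i l : ℕ) :
    ‖iteratedFDeriv ℝ i f x‖ ≤ C * (s ^ i * (i.factorial : ℝ) * M i) * ((s * t) ^ l * M l) := by
  have hA : 0 < A := one_pos.trans_le h.one_le
  have hi := h.pos i
  have hl := h.pos l
  have hLt : 0 ≤ L * t := (norm_nonneg _).trans hxyt
  have hfac : ((i + l).factorial : ℝ) ≤ 2 ^ (i + l) * (i.factorial * l.factorial) := by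
    rw [← Nat.add_choose_mul_factorial_mul_factorial i l]
    push_cast
    rw [mul_assoc]
    gcongr
    exact_mod_cast Nat.choose_le_two_pow _ _
  have hs0 : 0 ≤ s := le_trans (by positivity) hs
  have hst : 2 * σ * A * (L * t) ≤ s * t := by
    rw [← mul_assoc]; gcongr
  calc _ ≤ C * σ ^ (i + l) * ((i + l).factorial : ℝ) * M (i + l) * ‖x - y‖ ^ l
        / (l.factorial : ℝ) := _root_.norm_iteratedFDeriv_le_of_flat hf hfb hxy hy i l
    _ ≤ C * σ ^ (i + l) * (2 ^ (i + l) * (i.factorial * l.factorial)) *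
          (A ^ (i + l) * (M i * M l)) * (L * t) ^ l / (l.factorial : ℝ) := by
        have := h.pos (i + l)
        gcongr
        exact h.moderate i l
    _ = C * ((2 * σ * A) ^ i * (i.factorial : ℝ) * M i) *
          ((2 * σ * A * (L * t)) ^ l * M l) := by
        field_simp
        ring
    _ ≤ _ := by
        gcongr

/-- A function which is `C^∞` off `X`, with derivatives of order `k` there bounded by
`σ ^ k * k! * t ^ e * M (k + e)` where `t` is dominated by the distance to `X`, and which vanishes
on `X`, is of class `C_M` and flat on `X`. -/
theorem classCMOn_and_flatOn_of_bound {n : ℕ} {M : ℕ → ℝ} (hM : ∀ j, 0 < M j)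
    {S X : Set (EuclideanSpace ℝ (Fin n))} {f : EuclideanSpace ℝ (Fin n) → ℂ} (hS : IsOpen S)
    (hSX : IsOpen (S \ X)) (hf0 : ∀ x ∈ S ∩ X, f x = 0)
    (hf : ∀ x ∈ S \ X, ContDiffAt ℝ (⊤ : ℕ∞) f x)
    {t : EuclideanSpace ℝ (Fin n) → ℝ} {C σ τ L : ℝ} (hC : 0 < C) (hσ : 0 < σ)
    (hb : ∀ x ∈ S \ X, ∀ k e, ‖iteratedFDeriv ℝ k f x‖ ≤
      C * τ ^ e * σ ^ k * (k.factorial : ℝ) * t x ^ e * M (k + e))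
    (ht : ∀ x ∈ S \ X, 0 ≤ t x ∧ ∀ y ∈ S ∩ X, t x ≤ L * ‖x - y‖) :
    ClassCMOn M S f ∧ FlatOn S (X ∩ S) f := by
  obtain ⟨h1, h2, h3⟩ := contDiffOn_of_flat (f := f) hS hSX hf0 hf fun k => by
    refine ⟨C * τ ^ 2 * σ ^ k * (k.factorial : ℝ) * L ^ 2 * M (k + 2), fun x hx y hy => ?_⟩
    have := hM (k + 2)
    have h0 := (ht x hx).1
    calc _ ≤ _ := hb x hx k 2
      _ ≤ C * τ ^ 2 * σ ^ k * (k.factorial : ℝ) * (L * ‖x - y‖) ^ 2 * M (k + 2) := by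
          gcongr
          exact (ht x hx).2 y hy
      _ = _ := by ring
  refine ⟨⟨h1, C, σ, hC, hσ, fun k e x hx => (norm_mixedPartial_le _ _ _ _ _).trans ?_⟩,
    fun x hx k e => ?_⟩
  · have := hM k
    by_cases hxX : x ∈ X
    · rw [h2 k x ⟨hx, hxX⟩, norm_zero]
      positivity
    · rw [h3 k x ⟨hx, hxX⟩]
      simpa using hb x ⟨hx, hxX⟩ k 0
  · rw [mixedPartial, h2 k x ⟨hx.2, hx.1⟩]
    rfl

theorem norm_iteratedFDeriv_inv_comp_ofReal_le {E : Type*} [NormedAddCommGroup E] [NormedSpace ℝ E]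
    {M : ℕ → ℝ} (hM : ∀ j, 0 < M j) {q : E → ℝ} {x : E} {p : FormalMultilinearSeries ℝ E ℝ}
    (hp : HasFPowerSeriesAt q p x) {Φ : ℂ → ℂ} {c δ B t : ℝ} {N : ℕ} (hc : 0 < c) (hδ : 0 < δ)
    (hB : 0 < B) (ht : 0 < t) (hN : 1 ≤ N)
    (hpk : ∀ k, 1 ≤ k → ‖p k‖ ≤ c * t ^ 2 / (δ * t) ^ k)
    (hΦ : DifferentiableOn ℂ Φ (Metric.closedBall (q x : ℂ) (c * t ^ 2)))
    (hΦ1 : ∀ z ∈ Metric.closedBall (q x : ℂ) (c * t ^ 2),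
      1 ≤ ‖Φ z‖ ∧ ∀ k, 1 ≤ ‖Φ z‖ * ((2 * B * t) ^ k * M k) ^ N) :
    AnalyticAt ℝ (fun y => (Φ (q y))⁻¹) x ∧ ∀ k e,
      ‖iteratedFDeriv ℝ k (fun y => (Φ (q y))⁻¹) x‖ ≤
        1 * (2 * B) ^ e * (4 * B / δ) ^ k * (k.factorial : ℝ) * t ^ e * M (k + e) := by
  have hd : DifferentiableOn ℂ (fun z => (Φ z)⁻¹) (Metric.closedBall (q x : ℂ) (c * t ^ 2)) :=
    hΦ.inv fun z hz => norm_pos_iff.1 (one_pos.trans_le (hΦ1 z hz).1)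
  have key := fun (H : ℝ) hH => norm_iteratedFDeriv_comp_ofReal_le (H := H) hp
    (by positivity : 0 < c * t ^ 2) (by positivity : 0 < δ * t) hd hH hpk
  refine ⟨(key 1 fun z hz => ?_).1, fun k e => ?_⟩
  · rw [norm_inv]
    exact inv_le_one_of_one_le₀ (hΦ1 z hz).1
  · set a := (2 * B * t) ^ (k + e) * M (k + e) with ha
    have ha0 : 0 < a := mul_pos (by positivity) (hM _)
    refine ((key a fun z hz => ?_).2 k).trans (le_of_eq ?_)
    · rw [norm_inv]
      obtain ⟨h1, h2⟩ := hΦ1 z hz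
      have h0 : 0 < ‖Φ z‖ := one_pos.trans_le h1
      rw [inv_le_comm₀ h0 ha0]
      rcases le_total 1 a with h | h
      · exact (inv_le_one_of_one_le₀ h).trans h1
      · rw [inv_le_iff_one_le_mul₀ ha0]
        refine (h2 (k + e)).trans ?_
        gcongr
        exact pow_le_of_le_one ha0.le h (by omega)
    · rw [ha, show (4 : ℝ) * B / δ = 2 * (2 * B) / δ by ring]
      simp only [mul_pow, div_pow, pow_add]
      field_simp

theorem StronglyRegularWith.norm_iteratedFDeriv_mul_le {E : Type*} [NormedAddCommGroup E]
    [NormedSpace ℝ E] {M : ℕ → ℝ} {A : ℝ} (h : StronglyRegularWith M A) {f g : E → ℂ} {T : Set E}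
    {x : E} (hT : IsOpen T) (hx : x ∈ T) (hf : ContDiffOn ℝ (⊤ : ℕ∞) f T)
    (hg : ContDiffOn ℝ (⊤ : ℕ∞) g T)
    {C C' H s t δ : ℝ} {N l : ℕ} (hC : 0 < C) (hH : 0 ≤ H) (hs : 0 < s) (ht : 0 < t) (hδ : 0 < δ)
    (hfb : ∀ i j, ‖iteratedFDeriv ℝ i f x‖ ≤
      C * (s ^ i * (i.factorial : ℝ) * M i) * ((s * t) ^ j * M j))
    (hgb : ∀ k, ‖iteratedFDeriv ℝ k g x‖ ≤ (k.factorial : ℝ) * (2 ^ k * (H / (δ * t) ^ k)))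
    (hHl : H * ((s * A ^ N * t) ^ l * M l) ^ N ≤ C') (k e : ℕ) :
    ‖iteratedFDeriv ℝ k (fun y => f y * g y) x‖ ≤
      C * C' * (s * A ^ N) ^ e * (2 * (s + 2 * (s * A ^ N) / δ)) ^ k * (k.factorial : ℝ) * t ^ e *
        M (k + e) := by
  have hA : 0 < A := one_pos.trans_le h.one_le
  set s' := s * A ^ N with hs'
  have hs'0 : 0 < s' := by positivity
  have hC' : 0 ≤ C' := by
    refine le_trans ?_ hHl
    have := h.pos l
    positivity
  set D := s + 2 * s' / δ with hD
  have hD0 : 0 < D := by positivity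
  have hlead : ∀ m, (s * t) ^ (N * l + m) * M (N * l + m) * H ≤ C' * ((s' * t) ^ m * M m) := by
    intro m
    have hm := h.pos m
    calc _ ≤ (s * t) ^ (N * l + m) * ((A ^ N) ^ (N * l + m) * (M l ^ N * M m)) * H := by
          gcongr
          exact h.le_pow_mul l m N
      _ = H * ((s' * t) ^ l * M l) ^ N * ((s' * t) ^ m * M m) := by
          have hK : (s * t) ^ (N * l + m) * (A ^ N) ^ (N * l + m) = ((s' * t) ^ l) ^ N *
              (s' * t) ^ m := by
            rw [← mul_pow, mul_right_comm, ← pow_mul, ← pow_add, mul_comm l N]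
          rw [← mul_assoc, hK]
          ring
      _ ≤ _ := by gcongr
  have hterm : ∀ i ∈ Finset.range (k + 1), (k.choose i : ℝ) * ‖iteratedFDerivWithin ℝ i f T x‖ *
      ‖iteratedFDerivWithin ℝ (k - i) g T x‖ ≤
        C * C' * s' ^ e * D ^ k * (k.factorial : ℝ) * t ^ e * M (k + e) := by
    intro i hi
    have hik : i ≤ k := Finset.mem_range_succ_iff.1 hi
    obtain ⟨j, rfl⟩ := Nat.exists_eq_add_of_le hik
    rw [iteratedFDerivWithin_of_isOpen _ hT hx, iteratedFDerivWithin_of_isOpen _ hT hx,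
      Nat.add_sub_cancel_left]
    have hMi := h.pos i
    have hMj := h.pos (j + e)
    have hfac : ((i + j).choose i : ℝ) * (i.factorial : ℝ) * (j.factorial : ℝ) =
        ((i + j).factorial : ℝ) := by
      rw [Nat.choose_symm_add]
      exact_mod_cast Nat.add_choose_mul_factorial_mul_factorial i j
    calc _ ≤ ((i + j).choose i : ℝ) * (C * (s ^ i * (i.factorial : ℝ) * M i) *
            ((s * t) ^ (N * l + (j + e)) * M (N * l + (j + e)))) *
            ((j.factorial : ℝ) * (2 ^ j * (H / (δ * t) ^ j))) := by
          have := h.pos (N * l + (j + e))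
          gcongr
          · exact hfb _ _
          · exact hgb _
      _ = C * (((i + j).choose i : ℝ) * (i.factorial : ℝ) * (j.factorial : ℝ)) * s ^ i * M i *
            (2 ^ j / (δ * t) ^ j) *
            ((s * t) ^ (N * l + (j + e)) * M (N * l + (j + e)) * H) := by ring
      _ ≤ C * ((i + j).factorial : ℝ) * s ^ i * M i * (2 ^ j / (δ * t) ^ j) *
            (C' * ((s' * t) ^ (j + e) * M (j + e))) := by
          rw [hfac]
          exact mul_le_mul_of_nonneg_left (hlead _) (by positivity)
      _ = C * C' * s' ^ e * (s ^ i * (2 * s' / δ) ^ j) * ((i + j).factorial : ℝ) * t ^ e *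
            (M i * M (j + e)) := by
          simp only [mul_pow, div_pow, pow_add]
          field_simp
      _ ≤ C * C' * s' ^ e * (D ^ i * D ^ j) * ((i + j).factorial : ℝ) * t ^ e *
            M (i + j + e) := by
          rw [add_assoc i j e]
          gcongr
          · rw [hD]; simp only [le_add_iff_nonneg_right]; positivity
          · rw [hD]; simp only [le_add_iff_nonneg_left]; positivity
          · exact h.mul_le i (j + e)
      _ = _ := by rw [pow_add]
  rw [← iteratedFDerivWithin_of_isOpen k hT hx]
  refine (norm_iteratedFDerivWithin_mul_le hf hg hT.uniqueDiffOn hx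
    (by exact_mod_cast le_top)).trans ((Finset.sum_le_card_nsmul _ _ _ hterm).trans ?_)
  have hk2 : ((k + 1 : ℕ) : ℝ) ≤ 2 ^ k := by exact_mod_cast Nat.lt_two_pow_self
  have hMk := h.pos (k + e)
  rw [Finset.card_range, nsmul_eq_mul]
  calc _ ≤ 2 ^ k * (C * C' * s' ^ e * D ^ k * (k.factorial : ℝ) * t ^ e * M (k + e)) := by gcongr
    _ = _ := by rw [mul_pow 2 D]; ring
/-- division of finitely many `C_M` germs flat on a real-analytic
submanifold `X ∋ 0` by a common flat factor `v` whose zero set is exactly `X`. -/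
theorem stmt18 {n : ℕ} (hn : 1 ≤ n) (M : ℕ → ℝ) (hM : StronglyRegular M)
    (Ω : Set (EuclideanSpace ℝ (Fin n))) (hΩ : IsOpen Ω) (h0Ω : (0 : EuclideanSpace ℝ (Fin n)) ∈ Ω)
    (X : Set (EuclideanSpace ℝ (Fin n))) (hXΩ : X ⊆ Ω)
    (hX0 : (0 : EuclideanSpace ℝ (Fin n)) ∈ X)
    (hX : IsAnalyticSubmanifold X)
    (p : ℕ) (u : Fin p → EuclideanSpace ℝ (Fin n) → ℂ)
    (hu : ∀ i, ClassCMOn M Ω (u i)) (huflat : ∀ i, FlatOn Ω X (u i)) :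
    ∃ U : Set (EuclideanSpace ℝ (Fin n)), IsOpen U ∧
      (0 : EuclideanSpace ℝ (Fin n)) ∈ U ∧ U ⊆ Ω ∧
      ∃ v : EuclideanSpace ℝ (Fin n) → ℂ,
        ClassCMOn M U v ∧ FlatOn U (X ∩ U) v ∧
        (∀ x ∈ U, v x = 0 ↔ x ∈ X) ∧
        ∃ w : Fin p → EuclideanSpace ℝ (Fin n) → ℂ,
          (∀ i, ClassCMOn M U (w i)) ∧ (∀ i, FlatOn U (X ∩ U) (w i)) ∧
          ∀ i, ∀ x ∈ U, u i x = v x * w i x := by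
  classical
  obtain ⟨A, h⟩ := hM
  have hA : 0 < A := one_pos.trans_le h.one_le
  obtain ⟨N, c, C₁, b, hN, hc, hC₁, hb, hΦ⟩ := h.exists_flat_holomorphic
  obtain ⟨q, ρ₀, L, hρ₀, hL, hqa, hρΩ, hq⟩ := hX.exists_sq_dist_function hΩ hX0 h0Ω
  obtain ⟨ρ₁, Cq, hρ₁, hCq, hps⟩ := hqa.exists_uniform_hasFPowerSeriesAt
  obtain ⟨δ, hδ, hδp⟩ := exists_norm_powerSeries_le_div_pow q hc hL hρ₁ hCq
  choose Cu σu hCu hσu hub using fun i => (hu i).exists_norm_iteratedFDeriv_le h.pos hΩ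
  set σ := 1 + ∑ i, σu i with hσ
  have hσ0 : 0 < σ := add_pos_of_pos_of_nonneg one_pos (Finset.sum_nonneg fun i _ => (hσu i).le)
  have hσi : ∀ i, σu i ≤ σ := fun i =>
    (Finset.single_le_sum (fun j _ => (hσu j).le) (Finset.mem_univ i)).trans (by simp [hσ])
  set s := 2 * σ * A * (1 + L) with hs
  have hs0 : 0 < s := by positivity
  set B := s * A ^ N / b with hB
  have hB0 : 0 < B := by positivity
  obtain ⟨Φ, hΦ⟩ := hΦ B hB0
  set U := Metric.ball (0 : EuclideanSpace ℝ (Fin n)) (min ρ₀ ρ₁) with hU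
  have hUo : IsOpen U := Metric.isOpen_ball
  have hU₀ : ∀ x ∈ U, x ∈ Metric.ball (0 : EuclideanSpace ℝ (Fin n)) ρ₀ := fun x hx =>
    Metric.ball_subset_ball (min_le_left _ _) hx
  have hU₁ : ∀ x ∈ U, x ∈ Metric.ball (0 : EuclideanSpace ℝ (Fin n)) ρ₁ := fun x hx =>
    Metric.ball_subset_ball (min_le_right _ _) hx
  have hUΩ : U ⊆ Ω := fun x hx => hρΩ (hU₀ x hx)
  have hqX : ∀ x ∈ U, q x = 0 ↔ x ∈ X := fun x hx => (hq x (hU₀ x hx)).2.2.2.1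
  have hUX : IsOpen (U \ X) := by
    have hcont : ContinuousOn q U := fun x hx => (hq x (hU₀ x hx)).2.2.1.continuousWithinAt
    have := hcont.isOpen_inter_preimage hUo (isOpen_compl_singleton (x := (0 : ℝ)))
    convert this using 1
    ext x
    constructor
    · exact fun hx => ⟨hx.1, fun h0 => hx.2 ((hqX x hx.1).1 h0)⟩
    · exact fun hx => ⟨hx.1, fun h0 => hx.2 ((hqX x hx.1).2 h0)⟩
  have hqpos : ∀ x ∈ U \ X, 0 < q x := fun x hx =>
    (hq x (hU₀ x hx.1)).1.lt_of_ne fun h0 => hx.2 ((hqX x hx.1).1 h0.symm)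
  have htpos : ∀ x ∈ U \ X, 0 < √(q x) := fun x hx => Real.sqrt_pos.2 (hqpos x hx)
  have hsq : ∀ x ∈ U \ X, √(q x) ^ 2 = q x := fun x hx => Real.sq_sqrt (hqpos x hx).le
  have hpow : ∀ x ∈ U \ X, ∃ P : FormalMultilinearSeries ℝ (EuclideanSpace ℝ (Fin n)) ℝ,
      HasFPowerSeriesAt q P x ∧
      ∀ k, 1 ≤ k → ‖P k‖ ≤ c * √(q x) ^ 2 / (δ * √(q x)) ^ k := by
    intro x hx
    obtain ⟨P, hP, hPk⟩ := hps x (hU₁ x hx.1)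
    obtain ⟨-, hq1, -, -, hqd, -⟩ := hq x (hU₀ x hx.1)
    rw [hsq x hx]
    exact ⟨P, hP, hδp x P (hqpos x hx) hq1 hP hqd hPk⟩
  have hΦx : ∀ x ∈ U \ X,
      DifferentiableOn ℂ Φ (Metric.closedBall (q x : ℂ) (c * √(q x) ^ 2)) ∧
      (∀ z ∈ Metric.closedBall (q x : ℂ) (c * √(q x) ^ 2),
        1 ≤ ‖Φ z‖ ∧ ∀ k, 1 ≤ ‖Φ z‖ * ((2 * B * √(q x)) ^ k * M k) ^ N) ∧
      ∃ l, ∀ z ∈ Metric.closedBall (q x : ℂ) (c * √(q x) ^ 2),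
        ‖Φ z‖ * ((b * B * √(q x)) ^ l * M l) ^ N ≤ C₁ := by
    intro x hx
    have := hΦ _ (htpos x hx)
    rw [hsq x hx] at this
    rw [hsq x hx]
    exact this
  have hΦ0 : ∀ x ∈ U \ X, Φ (q x) ≠ 0 := fun x hx => norm_pos_iff.1 <| one_pos.trans_le <|
    ((hΦx x hx).2.1 _ (Metric.mem_closedBall_self (by positivity))).1
  have hdist : ∀ x ∈ U \ X, 0 ≤ √(q x) ∧ ∀ y ∈ U ∩ X, √(q x) ≤ L * ‖x - y‖ := fun x hx =>
    ⟨Real.sqrt_nonneg _, fun y hy => (hq x (hU₀ x hx.1)).2.2.2.2.2.2 y (hU₀ y hy.1) hy.2⟩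
  set v : EuclideanSpace ℝ (Fin n) → ℂ := fun x => if q x = 0 then 0 else (Φ (q x))⁻¹ with hv
  set w : Fin p → EuclideanSpace ℝ (Fin n) → ℂ := fun i x =>
    if q x = 0 then 0 else u i x * Φ (q x) with hw
  have hne : ∀ x ∈ U \ X, ∀ᶠ y in 𝓝 x, q y ≠ 0 := fun x hx =>
    (hq x (hU₀ x hx.1)).2.2.1.eventually_ne (hqpos x hx).ne'
  have hvx : ∀ x ∈ U \ X, v =ᶠ[𝓝 x] fun y => (Φ (q y))⁻¹ := fun x hx =>
    (hne x hx).mono fun y hy => by simp only [hv, if_neg hy]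
  have hwx : ∀ i, ∀ x ∈ U \ X, w i =ᶠ[𝓝 x] fun y => u i y * Φ (q y) := fun i x hx =>
    (hne x hx).mono fun y hy => by simp only [hw, if_neg hy]
  have hvb : ∀ x ∈ U \ X, AnalyticAt ℝ (fun y => (Φ (q y))⁻¹) x ∧ ∀ k e,
      ‖iteratedFDeriv ℝ k (fun y => (Φ (q y))⁻¹) x‖ ≤ 1 * (2 * B) ^ e * (4 * B / δ) ^ k *
        (k.factorial : ℝ) * √(q x) ^ e * M (k + e) := by
    intro x hx
    obtain ⟨P, hP, hPk⟩ := hpow x hx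
    obtain ⟨h1, h2, -⟩ := hΦx x hx
    exact norm_iteratedFDeriv_inv_comp_ofReal_le h.pos hP hc hδ hB0 (htpos x hx) hN hPk h1 h2
  have hΦb : ∀ x ∈ U \ X, AnalyticAt ℝ (fun y => Φ (q y)) x ∧ ∃ H l, 0 ≤ H ∧
      H * ((s * A ^ N * √(q x)) ^ l * M l) ^ N ≤ C₁ ∧ ∀ k,
      ‖iteratedFDeriv ℝ k (fun y => Φ (q y)) x‖ ≤
        (k.factorial : ℝ) * (2 ^ k * (H / (δ * √(q x)) ^ k)) := by
    intro x hx
    have ht := htpos x hx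
    obtain ⟨P, hP, hPk⟩ := hpow x hx
    obtain ⟨h1, -, l, h2⟩ := hΦx x hx
    have hbB : b * B = s * A ^ N := by rw [hB]; field_simp
    rw [hbB] at h2
    have hK : 0 < ((s * A ^ N * √(q x)) ^ l * M l) ^ N := by
      have := h.pos l
      positivity
    obtain ⟨h3, h4⟩ := norm_iteratedFDeriv_comp_ofReal_le
      (H := C₁ / ((s * A ^ N * √(q x)) ^ l * M l) ^ N) hP
      (by positivity : 0 < c * √(q x) ^ 2) (by positivity : 0 < δ * √(q x)) h1
      (fun z hz => (le_div_iff₀ hK).2 (h2 z hz)) hPk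
    exact ⟨h3, _, l, by positivity, (div_mul_cancel₀ _ hK.ne').le, h4⟩
  have huc : ∀ i, ∀ x ∈ Ω, ContDiffAt ℝ (⊤ : ℕ∞) (u i) x := fun i x hx =>
    (hu i).1.contDiffAt (hΩ.mem_nhds hx)
  have hux : ∀ i, ∀ x ∈ U \ X, ∀ k l, ‖iteratedFDeriv ℝ k (u i) x‖ ≤
      Cu i * (s ^ k * (k.factorial : ℝ) * M k) * ((s * √(q x)) ^ l * M l) := by
    intro i x hx k l
    obtain ⟨-, -, -, -, -, ⟨y, hyX, hxy, hseg⟩, -⟩ := hq x (hU₀ x hx.1)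
    have hi := hσu i
    refine h.norm_iteratedFDeriv_le_of_flat (huc i) (hCu i) hi (hub i) hseg
      (fun k => (huflat i).iteratedFDeriv_eq_zero hΩ hyX (hXΩ hyX) k) (Real.sqrt_nonneg _) ?_ ?_
      hxy k l
    · calc 2 * σu i * A ≤ 2 * σ * A * 1 := by rw [mul_one]; gcongr; exact hσi i
        _ ≤ s := by rw [hs]; gcongr; linarith
    · calc 2 * σu i * A * L ≤ 2 * σ * A * L := by gcongr; exact hσi i
        _ ≤ s := by rw [hs]; gcongr; linarith
  have hwb : ∀ i, ∀ x ∈ U \ X, ∀ k e, ‖iteratedFDeriv ℝ k (fun y => u i y * Φ (q y)) x‖ ≤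
      Cu i * C₁ * (s * A ^ N) ^ e * (2 * (s + 2 * (s * A ^ N) / δ)) ^ k * (k.factorial : ℝ) *
        √(q x) ^ e * M (k + e) := by
    intro i x hx k e
    obtain ⟨-, H, l, hH, hHl, hHk⟩ := hΦb x hx
    exact h.norm_iteratedFDeriv_mul_le hUX hx
      (fun y hy => (huc i y (hUΩ hy.1)).contDiffWithinAt)
      (fun y hy => (hΦb y hy).1.contDiffAt.contDiffWithinAt) (hCu i) hH hs0 (htpos x hx) hδ
      (hux i x hx) hHk hHl k e
  have hv' : ClassCMOn M U v ∧ FlatOn U (X ∩ U) v := by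
    refine classCMOn_and_flatOn_of_bound (τ := 2 * B) h.pos hUo hUX
      (fun x hx => if_pos ((hqX x hx.1).2 hx.2)) (fun x hx => ?_) one_pos
      (by positivity : 0 < 4 * B / δ) (fun x hx k e => ?_) hdist
    · exact (hvb x hx).1.contDiffAt.congr_of_eventuallyEq (hvx x hx)
    · rw [((hvx x hx).iteratedFDeriv ℝ k).eq_of_nhds]
      exact (hvb x hx).2 k e
  have hw' : ∀ i, ClassCMOn M U (w i) ∧ FlatOn U (X ∩ U) (w i) := by
    intro i
    have hi := hCu i
    refine classCMOn_and_flatOn_of_bound (τ := s * A ^ N) h.pos hUo hUX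
      (fun x hx => if_pos ((hqX x hx.1).2 hx.2)) (fun x hx => ?_)
      (by positivity : 0 < Cu i * C₁)
      (by positivity : 0 < 2 * (s + 2 * (s * A ^ N) / δ)) (fun x hx k e => ?_) hdist
    · exact ((huc i x (hUΩ hx.1)).mul (hΦb x hx).1.contDiffAt).congr_of_eventuallyEq (hwx i x hx)
    · rw [((hwx i x hx).iteratedFDeriv ℝ k).eq_of_nhds]
      exact hwb i x hx k e
  refine ⟨U, hUo, Metric.mem_ball_self (lt_min hρ₀ hρ₁), hUΩ, v, hv'.1, hv'.2, fun x hx => ?_, w,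
    fun i => (hw' i).1, fun i => (hw' i).2, fun i x hx => ?_⟩
  · by_cases hxX : x ∈ X
    · exact ⟨fun _ => hxX, fun _ => if_pos ((hqX x hx).2 hxX)⟩
    · refine ⟨fun h0 => ?_, fun h0 => absurd h0 hxX⟩
      rw [(hvx x ⟨hx, hxX⟩).eq_of_nhds] at h0
      exact absurd h0 (inv_ne_zero (hΦ0 x ⟨hx, hxX⟩))
  · by_cases hxX : x ∈ X
    · rw [(huflat i).eq_zero hxX, show v x = 0 from if_pos ((hqX x hx).2 hxX), zero_mul]
    · rw [(hvx x ⟨hx, hxX⟩).eq_of_nhds, (hwx i x ⟨hx, hxX⟩).eq_of_nhds, mul_left_comm,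
        inv_mul_cancel₀ (hΦ0 x ⟨hx, hxX⟩), mul_one]
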